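/- arXiv:2305.17297 — 5 statements merged into one kernel-verified Lean document; each statement's English description precedes it below -/
import Mathlib

section
/- Let W = X_trn (X_trn + A_trn)^†, where (X_trn + A_trn)^† = ((X_trn + A_trn)^T (X_trn + A_trn))^{-1} (X_trn + A_trn)^T. Assume that (X_trn + A_trn)^T (X_trn + A_trn), A_trn^T A_trn, P^T P, Z, and K_1 are all invertible. Then W = U Σ (P^T P)^{-1} Z^T K_1^{-1} H − U Σ Z^{-1} H H^T K_1^{-1} Z P^†, where P^† = (P^T P)^{-1} P^T. -/
open Matrix

/-- If `K = Y + J` with `K` invertible, then `J K⁻¹ Y = Y K⁻¹ J`. -/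
theorem Matrix.mul_inv_add_mul_comm {n R : Type*} [Fintype n] [DecidableEq n] [CommRing R]
    {K Y J : Matrix n n R} (hK : K = Y + J) (hdet : IsUnit K.det) :
    J * K⁻¹ * Y = Y * K⁻¹ * J := by
  have hY : Y = K - J := by rw [hK, add_sub_cancel_right]
  rw [hY, Matrix.mul_sub, Matrix.nonsing_inv_mul_cancel_right _ _ hdet, Matrix.sub_mul,
    Matrix.sub_mul, Matrix.mul_nonsing_inv _ hdet, Matrix.one_mul]

/-- If `M = Q F`, then `F (MᵀM)⁻¹ Fᵀ` is a right inverse of `QᵀQ`. -/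
theorem Matrix.gram_mul_conj_inv_eq_one {m n R : Type*} [Fintype m] [Fintype n] [DecidableEq n]
    [CommRing R] {M Q : Matrix m n R} {F : Matrix n n R} (hM : M = Q * F)
    (hdet : IsUnit (Mᵀ * M).det) :
    Qᵀ * Q * (F * (Mᵀ * M)⁻¹ * Fᵀ) = 1 := by
  have h : Fᵀ * (Qᵀ * Q * F * (Mᵀ * M)⁻¹) = 1 := by
    calc Fᵀ * (Qᵀ * Q * F * (Mᵀ * M)⁻¹) = (Q * F)ᵀ * (Q * F) * (Mᵀ * M)⁻¹ := by
          simp only [Matrix.transpose_mul, Matrix.mul_assoc]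
      _ = 1 := by rw [← hM, Matrix.mul_nonsing_inv _ hdet]
  simpa only [Matrix.mul_assoc] using mul_eq_one_comm.mp h

/-- **Lemma (closed form of `W = X_trn (X_trn + A_trn)^†`, overparameterized case).**
Let `r ≤ N < d`, `U` a `d × r` matrix with `UᵀU = I`, `S = Σ_trn` an invertible `r × r`
matrix, `V` an `N × r` matrix, `X = X_trn = U S Vᵀ`, and `A = A_trn` a `d × N` matrix with
`AᵀA` invertible, with pseudoinverse `A† = (AᵀA)⁻¹Aᵀ`.  With
`P = -(I - A A†) U S`, `H = Vᵀ A†`, `Z = I + Vᵀ A† U S`, `K₁ = H Hᵀ + Z (PᵀP)⁻¹ Zᵀ`,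
and assuming `(X+A)ᵀ(X+A)`, `PᵀP`, `Z`, `K₁` are invertible, the matrix
`W = X ((X+A)ᵀ(X+A))⁻¹ (X+A)ᵀ` satisfies
`W = U S (PᵀP)⁻¹ Zᵀ K₁⁻¹ H - U S Z⁻¹ H Hᵀ K₁⁻¹ Z P†` where `P† = (PᵀP)⁻¹ Pᵀ`. -/
theorem stmt_0 (d N r : ℕ) (hr : 0 < r) (hrN : r ≤ N) (hNd : N < d)
    (U : Matrix (Fin d) (Fin r) ℝ) (hU : Uᵀ * U = 1)
    (S : Matrix (Fin r) (Fin r) ℝ) (hS : IsUnit S.det)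
    (V : Matrix (Fin N) (Fin r) ℝ)
    (A : Matrix (Fin d) (Fin N) ℝ) (hA : IsUnit (Aᵀ * A).det)
    (Adag : Matrix (Fin N) (Fin d) ℝ) (hAdag : Adag = (Aᵀ * A)⁻¹ * Aᵀ)
    (X : Matrix (Fin d) (Fin N) ℝ) (hX : X = U * S * Vᵀ)
    (P : Matrix (Fin d) (Fin r) ℝ)
    (hP : P = -((1 : Matrix (Fin d) (Fin d) ℝ) - A * Adag) * U * S)
    (H : Matrix (Fin r) (Fin d) ℝ) (hH : H = Vᵀ * Adag)
    (Z : Matrix (Fin r) (Fin r) ℝ) (hZ : Z = 1 + Vᵀ * Adag * U * S)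
    (K₁ : Matrix (Fin r) (Fin r) ℝ) (hK₁ : K₁ = H * Hᵀ + Z * (Pᵀ * P)⁻¹ * Zᵀ)
    (hXA : IsUnit ((X + A)ᵀ * (X + A)).det)
    (hPP : IsUnit (Pᵀ * P).det) (hZ' : IsUnit Z.det) (hK₁' : IsUnit K₁.det)
    (W : Matrix (Fin d) (Fin d) ℝ)
    (hW : W = X * (((X + A)ᵀ * (X + A))⁻¹ * (X + A)ᵀ)) :
    W = U * S * (Pᵀ * P)⁻¹ * Zᵀ * K₁⁻¹ * H
        - U * S * Z⁻¹ * (H * Hᵀ) * K₁⁻¹ * Z * ((Pᵀ * P)⁻¹ * Pᵀ) := by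
  have hAdagA : Adag * A = 1 := by
    rw [hAdag, Matrix.mul_assoc, Matrix.nonsing_inv_mul _ hA]
  have hAP : Aᵀ * P = 0 := by
    have h : Aᵀ * (A * Adag) = Aᵀ := by
      rw [hAdag, ← Matrix.mul_assoc, Matrix.mul_nonsing_inv_cancel_left _ _ hA]
    rw [hP, Matrix.neg_mul, Matrix.neg_mul, Matrix.mul_neg, ← Matrix.mul_assoc,
      ← Matrix.mul_assoc, Matrix.mul_sub, h, Matrix.mul_one, sub_self, Matrix.zero_mul,
      Matrix.zero_mul, neg_zero]
  have hPA : Pᵀ * A = 0 := by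
    simpa only [Matrix.transpose_mul, Matrix.transpose_transpose, Matrix.transpose_zero]
      using congrArg Matrix.transpose hAP
  have hHH : H * Hᵀ = Vᵀ * (Aᵀ * A)⁻¹ * V := by
    have hsymm : ((Aᵀ * A)⁻¹)ᵀ = (Aᵀ * A)⁻¹ := by
      rw [Matrix.transpose_nonsing_inv, Matrix.transpose_mul, Matrix.transpose_transpose]
    calc H * Hᵀ = Vᵀ * (Adag * A) * ((Aᵀ * A)⁻¹ * V) := by
          conv_lhs => rw [hH, Matrix.transpose_mul, Matrix.transpose_transpose]
          conv_lhs => enter [2, 1]; rw [hAdag]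
          rw [Matrix.transpose_mul, Matrix.transpose_transpose, hsymm]
          simp only [Matrix.mul_assoc]
      _ = Vᵀ * (Aᵀ * A)⁻¹ * V := by rw [hAdagA, Matrix.mul_one, Matrix.mul_assoc]
  set F : Matrix (Fin N) (Fin N) ℝ := 1 + Adag * U * S * Vᵀ with hF
  set Q : Matrix (Fin d) (Fin N) ℝ := A - P * Z⁻¹ * Vᵀ with hQ
  have hVF : Vᵀ * F = Z * Vᵀ := by
    rw [hF, hZ]
    simp only [Matrix.mul_add, Matrix.add_mul, Matrix.mul_one, Matrix.one_mul, Matrix.mul_assoc]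
  have hZVF : Z⁻¹ * (Vᵀ * F) = Vᵀ := by
    rw [hVF, Matrix.nonsing_inv_mul_cancel_left _ _ hZ']
  have hM : X + A = Q * F := by
    rw [hQ, Matrix.sub_mul, Matrix.mul_assoc _ Vᵀ, Matrix.mul_assoc _ Z⁻¹, hZVF, hF, hP, hX]
    simp only [Matrix.mul_add, Matrix.sub_mul, Matrix.neg_mul, Matrix.mul_one, Matrix.one_mul,
      Matrix.mul_assoc]
    abel
  set E := F * ((X + A)ᵀ * (X + A))⁻¹ * Fᵀ with hE
  have hQE : Qᵀ * Q * E = 1 := Matrix.gram_mul_conj_inv_eq_one hM hXA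
  set J := Z * (Pᵀ * P)⁻¹ * Zᵀ with hJ
  set G := Z⁻¹ᵀ * (Pᵀ * P) * Z⁻¹ with hG
  have hZT : Zᵀ * Z⁻¹ᵀ = 1 := by
    rw [← Matrix.transpose_mul, Matrix.nonsing_inv_mul _ hZ', Matrix.transpose_one]
  have hJG : J * G = 1 := by
    calc J * G = Z * (Pᵀ * P)⁻¹ * (Zᵀ * Z⁻¹ᵀ) * (Pᵀ * P) * Z⁻¹ := by
          simp only [hJ, hG, Matrix.mul_assoc]
      _ = 1 := by
          rw [hZT, Matrix.mul_one, Matrix.nonsing_inv_mul_cancel_right _ _ hPP,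
            Matrix.mul_nonsing_inv _ hZ']
  have hGram : Qᵀ * Q = Aᵀ * A + V * G * Vᵀ := by
    have h₁ : Aᵀ * (P * Z⁻¹ * Vᵀ) = 0 := by
      rw [Matrix.mul_assoc, ← Matrix.mul_assoc, hAP, Matrix.zero_mul]
    have h₂ : (P * Z⁻¹ * Vᵀ)ᵀ * A = 0 := by
      simp only [Matrix.transpose_mul, Matrix.mul_assoc, hPA, Matrix.mul_zero]
    rw [hQ, Matrix.transpose_sub, Matrix.sub_mul, Matrix.mul_sub, Matrix.mul_sub, h₁, h₂, hG]
    simp only [Matrix.transpose_mul, Matrix.transpose_transpose, Matrix.mul_assoc, sub_zero,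
      zero_sub, sub_neg_eq_add]
  have hK : Vᵀ * (Aᵀ * A)⁻¹ * (Qᵀ * Q) = K₁ * (G * Vᵀ) := by
    rw [hGram, Matrix.mul_add, Matrix.nonsing_inv_mul_cancel_right _ _ hA, hK₁, Matrix.add_mul,
      ← Matrix.mul_assoc J, hJG, Matrix.one_mul, hHH, add_comm]
    simp only [Matrix.mul_assoc]
  have hVE : Vᵀ * E = J * K₁⁻¹ * (Vᵀ * (Aᵀ * A)⁻¹) := by
    have h : Vᵀ * (Aᵀ * A)⁻¹ = K₁ * (G * (Vᵀ * E)) := by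
      calc Vᵀ * (Aᵀ * A)⁻¹ = Vᵀ * (Aᵀ * A)⁻¹ * (Qᵀ * Q) * E := by
            rw [Matrix.mul_assoc _ (Qᵀ * Q), hQE, Matrix.mul_one]
        _ = K₁ * (G * (Vᵀ * E)) := by rw [hK]; simp only [Matrix.mul_assoc]
    rw [h, Matrix.mul_assoc, Matrix.nonsing_inv_mul_cancel_left _ _ hK₁', ← Matrix.mul_assoc J, hJG,
      Matrix.one_mul]
  have hAiQ : Vᵀ * (Aᵀ * A)⁻¹ * Qᵀ = H - H * Hᵀ * Z⁻¹ᵀ * Pᵀ := by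
    rw [hHH, hQ, Matrix.transpose_sub, Matrix.mul_sub, hH, hAdag]
    simp only [Matrix.transpose_mul, Matrix.transpose_transpose, Matrix.mul_assoc]
  have hcomm : J * K₁⁻¹ * (H * Hᵀ) = H * Hᵀ * K₁⁻¹ * J :=
    Matrix.mul_inv_add_mul_comm hK₁ hK₁'
  have hJZ : J * Z⁻¹ᵀ = Z * (Pᵀ * P)⁻¹ := by
    rw [hJ, Matrix.mul_assoc, hZT, Matrix.mul_one]
  calc W = U * S * (Z⁻¹ * (Vᵀ * E * Qᵀ)) := by
        have h : Z⁻¹ * (Vᵀ * E * Qᵀ)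
            = Z⁻¹ * (Vᵀ * F) * (((X + A)ᵀ * (X + A))⁻¹ * (Q * F)ᵀ) := by
          simp only [hE, Matrix.transpose_mul, Matrix.mul_assoc]
        rw [h, hZVF, ← hM, hW]
        conv_lhs => rw [hX, Matrix.mul_assoc (U * S), ← hX]
    _ = U * S * (Z⁻¹ * (J * K₁⁻¹ * H)) - U * S * (Z⁻¹ * (J * K₁⁻¹ * (H * Hᵀ) * Z⁻¹ᵀ * Pᵀ)) := by
        rw [hVE, Matrix.mul_assoc (J * K₁⁻¹), hAiQ]
        simp only [Matrix.mul_sub, Matrix.mul_assoc]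
    _ = _ := by
        congr 1
        · rw [hJ]
          simp only [Matrix.mul_assoc, Matrix.nonsing_inv_mul_cancel_left _ _ hZ']
        · rw [hcomm, Matrix.mul_assoc _ J, hJZ]
          simp only [Matrix.mul_assoc]
end

section
/- Let W = X_trn (X_trn + A_trn)^†, where (X_trn + A_trn)^† = ((X_trn + A_trn)^T (X_trn + A_trn))^{-1} (X_trn + A_trn)^T, and assume (X_trn + A_trn)^T (X_trn + A_trn), A_trn^T A_trn, P^T P, Z, and K_1 are all invertible. Let L be an r×N_tst real matrix and X_tst = U L. Then X_tst − W X_tst = U Σ (P^T P)^{-1} Z^T K_1^{-1} Σ^{-1} L. -/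
open Matrix

section LeastSquares

variable {m n k R : Type*} [Fintype m] [Fintype n] [DecidableEq n] [CommRing R]

/-- The Gram matrix of the component of `Q` orthogonal to the column space of `A`. -/
theorem gram_residual [DecidableEq m] (A : Matrix m n R) (Q : Matrix m k R) (hA : IsUnit (Aᵀ * A).det) :
    (-((1 - A * ((Aᵀ * A)⁻¹ * Aᵀ)) * Q))ᵀ * (-((1 - A * ((Aᵀ * A)⁻¹ * Aᵀ)) * Q)) =
      Qᵀ * Q - Qᵀ * (A * ((Aᵀ * A)⁻¹ * (Aᵀ * Q))) := by
  have hC : ∀ M : Matrix n k R, Aᵀ * (A * ((Aᵀ * A)⁻¹ * M)) = M := fun M => by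
    rw [← Matrix.mul_assoc, mul_nonsing_inv_cancel_left _ _ hA]
  simp only [transpose_neg, transpose_mul, transpose_sub, transpose_nonsing_inv,
    transpose_transpose, Matrix.neg_mul, Matrix.mul_neg, Matrix.sub_mul, Matrix.mul_sub,
    Matrix.one_mul, Matrix.mul_assoc, hC]
  abel

/-- The least squares solution of `(Q * Vᵀ + A) * Y = Q`, compressed by `Vᵀ`. -/
theorem transpose_mul_leastSquares [Fintype k] [DecidableEq k] (A : Matrix m n R)
    (Q : Matrix m k R) (V : Matrix n k R) (D Z K : Matrix k k R) (hA : IsUnit (Aᵀ * A).det)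
    (hB : IsUnit ((Q * Vᵀ + A)ᵀ * (Q * Vᵀ + A)).det)
    (hD : D = Qᵀ * Q - Qᵀ * (A * ((Aᵀ * A)⁻¹ * (Aᵀ * Q)))) (hD' : IsUnit D.det)
    (hZ : Z = 1 + Vᵀ * ((Aᵀ * A)⁻¹ * (Aᵀ * Q)))
    (hK : K = Vᵀ * ((Aᵀ * A)⁻¹ * V) + Z * D⁻¹ * Zᵀ) (hK' : IsUnit K.det) :
    Vᵀ * (((Q * Vᵀ + A)ᵀ * (Q * Vᵀ + A))⁻¹ * ((Q * Vᵀ + A)ᵀ * Q)) = 1 - D⁻¹ * Zᵀ * K⁻¹ := by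
  set G := D⁻¹ * Zᵀ * K⁻¹ with hG
  set Y := (Aᵀ * A)⁻¹ * (Aᵀ * Q * G + V * K⁻¹) with hY
  have hVY : Vᵀ * Y = 1 - G := by
    have h1 : Vᵀ * Y = K * K⁻¹ - G := by
      have h2 : K * K⁻¹ = Vᵀ * ((Aᵀ * A)⁻¹ * V) * K⁻¹ + Z * G := by
        nth_rw 1 [hK]
        simp only [hG, Matrix.add_mul, Matrix.mul_assoc]
      rw [h2, hY, hZ]
      simp only [Matrix.add_mul, Matrix.mul_add, Matrix.one_mul, Matrix.mul_assoc]
      abel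
    rw [h1, mul_nonsing_inv _ hK']
  have hAY : Aᵀ * (A * Y) = Aᵀ * Q * G + V * K⁻¹ := by
    rw [← Matrix.mul_assoc, hY, mul_nonsing_inv_cancel_left _ _ hA]
  have hDG : D * G = Zᵀ * K⁻¹ := by
    rw [hG, Matrix.mul_assoc, mul_nonsing_inv_cancel_left _ _ hD']
  have hZt : Zᵀ = 1 + Qᵀ * (A * ((Aᵀ * A)⁻¹ * V)) := by
    simp only [hZ, transpose_add, transpose_one, transpose_mul, transpose_nonsing_inv,
      transpose_transpose, Matrix.mul_assoc]
  have hQY : Qᵀ * (A * Y) = Qᵀ * Q * G - K⁻¹ := by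
    have h1 : Qᵀ * (A * Y) = (Qᵀ * Q * G - D * G) + (Zᵀ * K⁻¹ - K⁻¹) := by
      rw [hY, hZt, hD]
      simp only [Matrix.add_mul, Matrix.sub_mul, Matrix.mul_add, Matrix.one_mul, Matrix.mul_assoc]
      abel
    rw [h1, hDG]
    abel
  have hnormal : (Q * Vᵀ + A)ᵀ * (Q * Vᵀ + A) * Y = (Q * Vᵀ + A)ᵀ * Q := by
    have h1 : (Q * Vᵀ + A) * Y = Q - Q * G + A * Y := by
      rw [Matrix.add_mul, Matrix.mul_assoc, hVY, Matrix.mul_sub, Matrix.mul_one]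
    rw [Matrix.mul_assoc, h1]
    simp only [transpose_add, transpose_mul, transpose_transpose, Matrix.add_mul, Matrix.mul_add,
      Matrix.mul_sub, Matrix.mul_assoc, hAY, hQY]
    abel
  rw [← hnormal, nonsing_inv_mul_cancel_left _ _ hB, hVY]

end LeastSquares

/-- **Lemma (bias term, overparameterized case).**
With the same setup as before (`r ≤ N < d`, `UᵀU = I`, `S = Σ_trn` invertible,
`X = U S Vᵀ`, `A† = (AᵀA)⁻¹Aᵀ`, `P = -(I - A A†) U S`, `H = Vᵀ A†`,
`Z = I + Vᵀ A† U S`, `K₁ = H Hᵀ + Z (PᵀP)⁻¹ Zᵀ`, all the relevant matrices invertible,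
`W = X ((X+A)ᵀ(X+A))⁻¹ (X+A)ᵀ`), if `L` is `r × N_tst` and `X_tst = U L`, then
`X_tst - W X_tst = U S (PᵀP)⁻¹ Zᵀ K₁⁻¹ S⁻¹ L`. -/
theorem stmt_1 (d N r Ntst : ℕ) (hr : 0 < r) (hrN : r ≤ N) (hNd : N < d) (hNtst : 0 < Ntst)
    (U : Matrix (Fin d) (Fin r) ℝ) (hU : Uᵀ * U = 1)
    (S : Matrix (Fin r) (Fin r) ℝ) (hS : IsUnit S.det)
    (V : Matrix (Fin N) (Fin r) ℝ)
    (A : Matrix (Fin d) (Fin N) ℝ) (hA : IsUnit (Aᵀ * A).det)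
    (Adag : Matrix (Fin N) (Fin d) ℝ) (hAdag : Adag = (Aᵀ * A)⁻¹ * Aᵀ)
    (X : Matrix (Fin d) (Fin N) ℝ) (hX : X = U * S * Vᵀ)
    (P : Matrix (Fin d) (Fin r) ℝ)
    (hP : P = -((1 : Matrix (Fin d) (Fin d) ℝ) - A * Adag) * U * S)
    (H : Matrix (Fin r) (Fin d) ℝ) (hH : H = Vᵀ * Adag)
    (Z : Matrix (Fin r) (Fin r) ℝ) (hZ : Z = 1 + Vᵀ * Adag * U * S)
    (K₁ : Matrix (Fin r) (Fin r) ℝ) (hK₁ : K₁ = H * Hᵀ + Z * (Pᵀ * P)⁻¹ * Zᵀ)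
    (hXA : IsUnit ((X + A)ᵀ * (X + A)).det)
    (hPP : IsUnit (Pᵀ * P).det) (hZ' : IsUnit Z.det) (hK₁' : IsUnit K₁.det)
    (W : Matrix (Fin d) (Fin d) ℝ)
    (hW : W = X * (((X + A)ᵀ * (X + A))⁻¹ * (X + A)ᵀ))
    (L : Matrix (Fin r) (Fin Ntst) ℝ)
    (Xtst : Matrix (Fin d) (Fin Ntst) ℝ) (hXtst : Xtst = U * L) :
    Xtst - W * Xtst = U * S * (Pᵀ * P)⁻¹ * Zᵀ * K₁⁻¹ * S⁻¹ * L := by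
  subst hAdag hX hH hW hXtst
  have hD : Pᵀ * P = (U * S)ᵀ * (U * S) -
      (U * S)ᵀ * (A * ((Aᵀ * A)⁻¹ * (Aᵀ * (U * S)))) := by
    rw [← gram_residual A (U * S) hA, hP]
    simp only [Matrix.neg_mul, Matrix.mul_assoc]
  have hZQ : Z = 1 + Vᵀ * ((Aᵀ * A)⁻¹ * (Aᵀ * (U * S))) := by
    rw [hZ]
    simp only [Matrix.mul_assoc]
  have hHH : Vᵀ * ((Aᵀ * A)⁻¹ * Aᵀ) * (Vᵀ * ((Aᵀ * A)⁻¹ * Aᵀ))ᵀ = Vᵀ * ((Aᵀ * A)⁻¹ * V) := by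
    have hC : Aᵀ * (A * ((Aᵀ * A)⁻¹ * V)) = V := by
      rw [← Matrix.mul_assoc, mul_nonsing_inv_cancel_left _ _ hA]
    simp only [transpose_mul, transpose_nonsing_inv, transpose_transpose, Matrix.mul_assoc, hC]
  rw [hHH] at hK₁
  have key := transpose_mul_leastSquares A (U * S) V (Pᵀ * P) Z K₁ hA hXA hD hPP hZQ hK₁ hK₁'
  have hUL : U * L = U * S * (S⁻¹ * L) := by
    rw [Matrix.mul_assoc, mul_nonsing_inv_cancel_left _ _ hS]
  calc _ = U * S * (1 - Vᵀ * (((U * S * Vᵀ + A)ᵀ * (U * S * Vᵀ + A))⁻¹ *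
        ((U * S * Vᵀ + A)ᵀ * (U * S)))) * (S⁻¹ * L) := by
        rw [hUL]
        generalize U * S * Vᵀ + A = B
        simp only [Matrix.mul_sub, Matrix.sub_mul, Matrix.mul_one, Matrix.mul_assoc]
    _ = _ := by
        rw [key, sub_sub_cancel]
        simp only [Matrix.mul_assoc]
end

section
/- Assume A_trn^T A_trn, P^T P, and U^T (I_d − A_trn A_trn^†) U are invertible. Then P^† U = −Σ^{-1}, where P^† = (P^T P)^{-1} P^T. -/
open Matrix

/-- The complementary projection `Q = 1 - A (AᵀA)⁻¹ Aᵀ` satisfies `Qᵀ Q = Qᵀ`. -/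
theorem transpose_mul_self_one_sub_projection {m n R : Type*} [Fintype m] [DecidableEq m]
    [Fintype n] [DecidableEq n] [CommRing R] (A : Matrix m n R) (hA : IsUnit (Aᵀ * A).det) :
    (1 - A * ((Aᵀ * A)⁻¹ * Aᵀ))ᵀ * (1 - A * ((Aᵀ * A)⁻¹ * Aᵀ)) =
      (1 - A * ((Aᵀ * A)⁻¹ * Aᵀ))ᵀ := by
  have hsymm : (1 - A * ((Aᵀ * A)⁻¹ * Aᵀ))ᵀ = 1 - A * ((Aᵀ * A)⁻¹ * Aᵀ) := by
    simp [transpose_nonsing_inv, Matrix.mul_assoc]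
  have hQA : (1 - A * ((Aᵀ * A)⁻¹ * Aᵀ)) * A = 0 := by
    rw [Matrix.sub_mul, Matrix.one_mul, Matrix.mul_assoc, Matrix.mul_assoc,
      nonsing_inv_mul _ hA, Matrix.mul_one, sub_self]
  rw [hsymm, Matrix.mul_sub, Matrix.mul_one, ← Matrix.mul_assoc _ A, hQA, Matrix.zero_mul,
    sub_zero]

/-- **Lemma (`P† U = -Σ⁻¹`).**
Let `r ≤ N < d`, `U` a `d × r` matrix with `UᵀU = I`, `S = Σ` an invertible `r × r` matrix,
`A` a `d × N` matrix with `AᵀA` invertible, `A† = (AᵀA)⁻¹Aᵀ`, and `P = -(I - A A†) U S`.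
If `PᵀP` and `Uᵀ(I - A A†)U` are invertible, then `P† U = -S⁻¹`,
where `P† = (PᵀP)⁻¹ Pᵀ`. -/
theorem stmt_3 (d N r : ℕ) (hr : 0 < r) (hrN : r ≤ N) (hNd : N < d)
    (U : Matrix (Fin d) (Fin r) ℝ) (hU : Uᵀ * U = 1)
    (S : Matrix (Fin r) (Fin r) ℝ) (hS : IsUnit S.det)
    (A : Matrix (Fin d) (Fin N) ℝ) (hA : IsUnit (Aᵀ * A).det)
    (Adag : Matrix (Fin N) (Fin d) ℝ) (hAdag : Adag = (Aᵀ * A)⁻¹ * Aᵀ)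
    (P : Matrix (Fin d) (Fin r) ℝ)
    (hP : P = -((1 : Matrix (Fin d) (Fin d) ℝ) - A * Adag) * U * S)
    (hPP : IsUnit (Pᵀ * P).det)
    (hUAU : IsUnit (Uᵀ * ((1 : Matrix (Fin d) (Fin d) ℝ) - A * Adag) * U).det) :
    (Pᵀ * P)⁻¹ * Pᵀ * U = -S⁻¹ := by
  have hQ : (1 - A * Adag)ᵀ * (1 - A * Adag) = (1 - A * Adag)ᵀ := by
    rw [hAdag]
    exact transpose_mul_self_one_sub_projection A hA
  have hPQ : Pᵀ * (1 - A * Adag) = Pᵀ := by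
    rw [hP, Matrix.mul_assoc, Matrix.neg_mul, transpose_neg, transpose_mul, Matrix.neg_mul,
      Matrix.mul_assoc, hQ]
  have hPUS : Pᵀ * U * S = -(Pᵀ * P) := by
    have hP' : (1 - A * Adag) * U * S = -P := by rw [hP]; simp only [Matrix.neg_mul, neg_neg]
    rw [← Matrix.mul_neg, ← hP', Matrix.mul_assoc (1 - A * Adag), ← Matrix.mul_assoc Pᵀ, hPQ,
      Matrix.mul_assoc]
  have hPU : Pᵀ * U = -(Pᵀ * P) * S⁻¹ := by
    rw [← hPUS, mul_nonsing_inv_cancel_right _ _ hS]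
  rw [Matrix.mul_assoc, hPU, Matrix.neg_mul, Matrix.mul_neg, ← Matrix.mul_assoc,
    nonsing_inv_mul _ hPP, Matrix.one_mul]
end

section
/- Suppose A_trn = Ũ S, where Ũ is a random d×d orthogonal matrix distributed according to the Haar measure on O(d), independent of the random d×N matrix S, S almost surely has rank N, and every entry of (S^T S)^{-1} S^T is integrable. Then E[V^T A_trn^† U Σ] = 0, and hence E[Z] = I_r, where Z = I_r + V^T A_trn^† U Σ and A_trn^† = (A_trn^T A_trn)^{-1} A_trn^T. -/
open MeasureTheory ProbabilityTheory Matrix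

instance matrixMeasurableSpace {m n α : Type*} [MeasurableSpace α] :
    MeasurableSpace (Matrix m n α) :=
  inferInstanceAs (MeasurableSpace (m → n → α))

/-- The pseudo-inverse `(MᵀM)⁻¹Mᵀ` depends measurably on the matrix `M`. -/
lemma measurable_gram_inv_mul_transpose_apply {m n : Type*} [Fintype m] [Fintype n]
    [DecidableEq n] (i : n) (j : m) :
    Measurable (fun M : Matrix m n ℝ => ((Mᵀ * M)⁻¹ * Mᵀ) i j) := by
  have hdet : Continuous fun M : m → n → ℝ =>
      ((Matrix.of M)ᵀ * Matrix.of M).det :=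
    Continuous.matrix_det ((continuous_id.matrix_transpose).matrix_mul continuous_id)
  have hadj : Continuous fun M : m → n → ℝ =>
      (((Matrix.of M)ᵀ * Matrix.of M).adjugate * (Matrix.of M)ᵀ) i j :=
    ((((continuous_id.matrix_transpose).matrix_mul
      continuous_id).matrix_adjugate).matrix_mul
        continuous_id.matrix_transpose).matrix_elem i j
  have h : Measurable fun M : m → n → ℝ =>
      ((Matrix.of M)ᵀ * Matrix.of M).det⁻¹ *
        (((Matrix.of M)ᵀ * Matrix.of M).adjugate * (Matrix.of M)ᵀ) i j :=
    hdet.measurable.inv.mul hadj.measurable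
  have hinv (M : Matrix m n ℝ) : ((Mᵀ * M)⁻¹ * Mᵀ) i j =
      (Mᵀ * M).det⁻¹ * ((Mᵀ * M).adjugate * Mᵀ) i j := by
    rw [Matrix.inv_def, Ring.inverse_eq_inv', Matrix.smul_mul, Matrix.smul_apply, smul_eq_mul]
  simp only [hinv]
  exact h

lemma measurable_matrix_apply {m n : Type*} (i : m) (j : n) :
    Measurable (fun M : Matrix m n ℝ => M i j) :=
  (measurable_pi_apply j).comp (measurable_pi_apply i)

/-- Left multiplication by an orthogonal matrix multiplies the pseudo-inverse on the right by
its transpose. -/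
lemma gram_inv_mul_transpose_orthogonal_mul {m n : Type*} [Fintype m] [Fintype n]
    [DecidableEq m] [DecidableEq n] {Q : Matrix m m ℝ} (hQ : Q ∈ Matrix.orthogonalGroup m ℝ)
    (M : Matrix m n ℝ) :
    ((Q * M)ᵀ * (Q * M))⁻¹ * (Q * M)ᵀ = (Mᵀ * M)⁻¹ * Mᵀ * Qᵀ := by
  have hQ' : Qᵀ * Q = 1 := (Matrix.mem_orthogonalGroup_iff' m ℝ).1 hQ
  have h : (Q * M)ᵀ * (Q * M) = Mᵀ * M := by
    rw [Matrix.transpose_mul, Matrix.mul_assoc, ← Matrix.mul_assoc Qᵀ, hQ', Matrix.one_mul]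
  rw [h, Matrix.transpose_mul, Matrix.mul_assoc]

/-- A random matrix whose law is invariant under left multiplication by orthogonal matrices has
entries of mean zero. -/
lemma integral_apply_eq_zero_of_orthogonal_invariant {m Ω : Type*} [Fintype m] [DecidableEq m]
    [MeasurableSpace Ω] {μ : Measure Ω} {Q : Ω → Matrix m m ℝ} (hQ : Measurable Q)
    (hinv : ∀ R ∈ Matrix.orthogonalGroup m ℝ, (μ.map Q).map (fun M => R * M) = μ.map Q)
    (i j : m) : ∫ ω, Q ω i j ∂μ = 0 := by
  have hneg := hinv (-1) ((Matrix.mem_orthogonalGroup_iff m ℝ).2 (by simp))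
  simp only [neg_mul, one_mul] at hneg
  have hmeas : Measurable (fun M : Matrix m m ℝ => -M) :=
    measurable_pi_lambda _ fun a => measurable_pi_lambda _ fun b =>
      (measurable_matrix_apply a b).neg
  have happ : Measurable (fun M : Matrix m m ℝ => M i j) := measurable_matrix_apply i j
  have h1 : ∫ M, M i j ∂(μ.map Q) = ∫ ω, Q ω i j ∂μ :=
    integral_map hQ.aemeasurable happ.aestronglyMeasurable
  have h2 : ∫ M, M i j ∂((μ.map Q).map fun M => -M) = ∫ M, (-M) i j ∂(μ.map Q) :=
    integral_map hmeas.aemeasurable happ.aestronglyMeasurable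
  rw [hneg] at h2
  simp only [Matrix.neg_apply, integral_neg] at h2
  linarith

/-- **Lemma (`E[Z] = I`).**
Let `r ≤ N < d`, `U` a `d × r` matrix with `UᵀU = I`, `Σ = S` an invertible `r × r` matrix,
and `V` an `N × r` matrix.  Suppose `A_trn = Ũ S'` where `Ũ` is Haar uniformly random on
`O(d)` — its law is the unique probability measure supported on the orthogonal group that
is invariant under left multiplication by fixed orthogonal matrices — independent of the
random `d × N` matrix `S'`, `S'` almost surely has rank `N`, and every entry of
`(S'ᵀ S')⁻¹ S'ᵀ` is integrable.  Then with `A† = (AᵀA)⁻¹Aᵀ`,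
`E[Vᵀ A† U S] = 0` and hence `E[Z] = I_r`, where `Z = I_r + Vᵀ A† U S` (entrywise). -/
theorem stmt_7 (d N r : ℕ) (hr : 0 < r) (hrN : r ≤ N) (hNd : N < d)
    (U : Matrix (Fin d) (Fin r) ℝ) (hU : Uᵀ * U = 1)
    (S : Matrix (Fin r) (Fin r) ℝ) (hS : IsUnit S.det)
    (V : Matrix (Fin N) (Fin r) ℝ)
    (Ω : Type*) [MeasurableSpace Ω] (μ : Measure Ω) [IsProbabilityMeasure μ]
    (Ut : Ω → Matrix (Fin d) (Fin d) ℝ) (hUtmeas : Measurable Ut)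
    (St : Ω → Matrix (Fin d) (Fin N) ℝ) (hStmeas : Measurable St)
    (hUtsupp : ∀ᵐ ω ∂μ, Ut ω ∈ Matrix.orthogonalGroup (Fin d) ℝ)
    (hUtinv : ∀ R ∈ Matrix.orthogonalGroup (Fin d) ℝ,
      (μ.map Ut).map (fun M => R * M) = μ.map Ut)
    (hindep : IndepFun Ut St μ)
    (hStrank : ∀ᵐ ω ∂μ, (St ω).rank = N)
    (hStint : ∀ (i : Fin N) (j : Fin d),
      Integrable (fun ω => ((((St ω)ᵀ * St ω)⁻¹) * (St ω)ᵀ) i j) μ)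
    (A : Ω → Matrix (Fin d) (Fin N) ℝ) (hA : A = fun ω => Ut ω * St ω)
    (Adag : Ω → Matrix (Fin N) (Fin d) ℝ)
    (hAdag : Adag = fun ω => ((A ω)ᵀ * A ω)⁻¹ * (A ω)ᵀ)
    (Z : Ω → Matrix (Fin r) (Fin r) ℝ)
    (hZ : Z = fun ω => 1 + Vᵀ * Adag ω * U * S) :
    (∀ i j : Fin r, ∫ ω, (Vᵀ * Adag ω * U * S) i j ∂μ = 0) ∧
    (∀ i j : Fin r, ∫ ω, Z ω i j ∂μ = (1 : Matrix (Fin r) (Fin r) ℝ) i j) := by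
  have hbound (k j : Fin d) : ∀ᵐ ω ∂μ, ‖Ut ω k j‖ ≤ 1 := by
    filter_upwards [hUtsupp] with ω hω using entry_norm_bound_of_unitary hω k j
  have hprod_int (i : Fin N) (j k : Fin d) :
      Integrable (fun ω => (((St ω)ᵀ * St ω)⁻¹ * (St ω)ᵀ) i k * Ut ω j k) μ :=
    (hStint i k).mul_bdd (c := 1)
      ((measurable_matrix_apply j k).comp hUtmeas).aestronglyMeasurable (hbound j k)
  have hprod_zero (i : Fin N) (j k : Fin d) :
      ∫ ω, (((St ω)ᵀ * St ω)⁻¹ * (St ω)ᵀ) i k * Ut ω j k ∂μ = 0 := by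
    have hind := hindep.symm.comp (measurable_gram_inv_mul_transpose_apply i k)
      (measurable_matrix_apply j k)
    have := hind.integral_fun_mul_eq_mul_integral (hStint i k).aestronglyMeasurable
      ((measurable_matrix_apply j k).comp hUtmeas).aestronglyMeasurable
    simp only [Function.comp_apply] at this
    rw [this, integral_apply_eq_zero_of_orthogonal_invariant hUtmeas hUtinv, mul_zero]
  have hAdag_ae (i : Fin N) (j : Fin d) : (fun ω => Adag ω i j) =ᵐ[μ]
      fun ω => ∑ k, (((St ω)ᵀ * St ω)⁻¹ * (St ω)ᵀ) i k * Ut ω j k := by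
    filter_upwards [hUtsupp] with ω hω
    simp only [hAdag, hA, gram_inv_mul_transpose_orthogonal_mul hω]
    rw [Matrix.mul_apply]
    simp only [Matrix.transpose_apply]
  have hAdag_int (i : Fin N) (j : Fin d) : Integrable (fun ω => Adag ω i j) μ :=
    (integrable_finsetSum _ fun k _ => hprod_int i j k).congr (hAdag_ae i j).symm
  have hAdag_zero (i : Fin N) (j : Fin d) : ∫ ω, Adag ω i j ∂μ = 0 := by
    rw [integral_congr_ae (hAdag_ae i j), integral_finsetSum _ fun k _ => hprod_int i j k]
    exact Finset.sum_eq_zero fun k _ => hprod_zero i j k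
  have hexpand (i j : Fin r) (ω : Ω) : (Vᵀ * Adag ω * U * S) i j =
      ∑ l : Fin d, ∑ k : Fin N, V k i * Adag ω k l * (U * S) l j := by
    rw [Matrix.mul_assoc _ U S, Matrix.mul_apply]
    simp only [Matrix.mul_apply (M := Vᵀ), Matrix.transpose_apply, Finset.sum_mul]
  have hterm (i j : Fin r) (l : Fin d) (k : Fin N) :
      Integrable (fun ω => V k i * Adag ω k l * (U * S) l j) μ :=
    ((hAdag_int k l).const_mul _).mul_const _
  have hint (i j : Fin r) : Integrable (fun ω => (Vᵀ * Adag ω * U * S) i j) μ := by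
    simp only [hexpand]
    exact integrable_finsetSum _ fun l _ => integrable_finsetSum _ fun k _ => hterm i j l k
  have hzero (i j : Fin r) : ∫ ω, (Vᵀ * Adag ω * U * S) i j ∂μ = 0 := by
    simp only [hexpand]
    rw [integral_finsetSum _ fun l _ => integrable_finsetSum _ fun k _ => hterm i j l k]
    refine Finset.sum_eq_zero fun l _ => ?_
    rw [integral_finsetSum _ fun k _ => hterm i j l k]
    refine Finset.sum_eq_zero fun k _ => ?_
    rw [integral_mul_const, integral_const_mul, hAdag_zero, mul_zero, zero_mul]
  refine ⟨hzero, fun i j => ?_⟩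
  simp only [hZ, Matrix.add_apply]
  rw [integral_add (integrable_const _) (hint i j), hzero]
  simp
end

section
/- Fix c > 1, η > 0, a positive integer r, and an invertible r×r diagonal matrix Σ with positive diagonal entries. For each N, let d = d(N) satisfy d(N)/N → c, let A_N be a d×N random matrix with i.i.d. Gaussian entries of mean 0 and variance η²/d, let U_N be a d×r matrix with U_N^T U_N = I_r, and let V_N be an N×r matrix with V_N^T V_N = I_r. With H_N = V_N^T A_N^†, Z_N = I_r + V_N^T A_N^† U_N Σ, P_N = −(I_d − A_N A_N^†) U_N Σ, and K_1^{(N)} = H_N H_N^T + Z_N (P_N^T P_N)^{-1} Z_N^T, one has lim_{N→∞} E[K_1^{(N)}] = (1/η²)(c/(c−1)) I_r + (c/(c−1)) Σ^{-2}. -/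
open MeasureTheory ProbabilityTheory Matrix Filter

/-- The law of a `d × N` random matrix with i.i.d. real Gaussian entries of mean `0`
and variance `v`. -/
noncomputable def gaussMatrix (d N : ℕ) (v : NNReal) : Measure (Matrix (Fin d) (Fin N) ℝ) :=
  Measure.pi fun _ : Fin d => Measure.pi fun _ : Fin N => gaussianReal 0 v

/-- The Moore–Penrose pseudoinverse `A† = (AᵀA)⁻¹Aᵀ` of a full-column-rank matrix. -/
noncomputable def pinv {d N : ℕ} (A : Matrix (Fin d) (Fin N) ℝ) : Matrix (Fin N) (Fin d) ℝ :=
  (Aᵀ * A)⁻¹ * Aᵀ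

/-- The matrix `P = -(I - A A†) U Σ`. -/
noncomputable def Pmat {d N r : ℕ} (A : Matrix (Fin d) (Fin N) ℝ)
    (U : Matrix (Fin d) (Fin r) ℝ) (S : Matrix (Fin r) (Fin r) ℝ) :
    Matrix (Fin d) (Fin r) ℝ :=
  -((1 : Matrix (Fin d) (Fin d) ℝ) - A * pinv A) * U * S

/-- The matrix `H = Vᵀ A†`. -/
noncomputable def Hmat {d N r : ℕ} (A : Matrix (Fin d) (Fin N) ℝ)
    (V : Matrix (Fin N) (Fin r) ℝ) : Matrix (Fin r) (Fin d) ℝ :=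
  Vᵀ * pinv A

/-- The matrix `Z = I_r + Vᵀ A† U Σ`. -/
noncomputable def Zmat {d N r : ℕ} (A : Matrix (Fin d) (Fin N) ℝ)
    (U : Matrix (Fin d) (Fin r) ℝ) (V : Matrix (Fin N) (Fin r) ℝ)
    (S : Matrix (Fin r) (Fin r) ℝ) : Matrix (Fin r) (Fin r) ℝ :=
  1 + Vᵀ * pinv A * U * S

/-- The matrix `K₁ = H Hᵀ + Z (PᵀP)⁻¹ Zᵀ`. -/
noncomputable def K1mat {d N r : ℕ} (A : Matrix (Fin d) (Fin N) ℝ)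
    (U : Matrix (Fin d) (Fin r) ℝ) (V : Matrix (Fin N) (Fin r) ℝ)
    (S : Matrix (Fin r) (Fin r) ℝ) : Matrix (Fin r) (Fin r) ℝ :=
  Hmat A V * (Hmat A V)ᵀ +
    Zmat A U V S * ((Pmat A U S)ᵀ * Pmat A U S)⁻¹ * (Zmat A U V S)ᵀ

/-- The law of a vector with i.i.d. centered real Gaussian coordinates of variance `v`. -/
noncomputable abbrev gaussVec (ι : Type*) [Fintype ι] (v : NNReal) : Measure (ι → ℝ) :=
  Measure.pi fun _ : ι => gaussianReal 0 v

/-- The law of an array with i.i.d. centered real Gaussian entries of variance `v`. -/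
noncomputable abbrev gaussArray (κ ι : Type*) [Fintype κ] [Fintype ι] (v : NNReal) :
    Measure (κ → ι → ℝ) :=
  Measure.pi fun _ : κ => gaussVec ι v

section GaussianVectors

variable {ι κ : Type*} [Fintype ι] [Fintype κ] {v : NNReal}

lemma charFun_gaussVec (t : EuclideanSpace ℝ ι) :
    charFun ((gaussVec ι v).map (WithLp.toLp 2)) t =
      Complex.exp (-(v * (∑ i, t i ^ 2 : ℝ) / 2)) := by
  rw [gaussVec, charFun_pi]
  simp_rw [charFun_gaussianReal, ← Complex.exp_sum]
  congr 1
  push_cast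
  simp [Finset.mul_sum, Finset.sum_div]

/-- A matrix with orthonormal rows maps a white Gaussian vector to a white Gaussian vector. -/
lemma measurePreserving_mulVec [DecidableEq κ] (B : Matrix κ ι ℝ) (hB : B * Bᵀ = 1) :
    MeasurePreserving (fun x => B *ᵥ x) (gaussVec ι v) (gaussVec κ v) := by
  have hm : Measurable (fun x : ι → ℝ => B *ᵥ x) :=
    (Continuous.matrix_mulVec continuous_const continuous_id).measurable
  refine ⟨hm, (MeasurableEquiv.toLp 2 (κ → ℝ)).map_measurableEquiv_injective ?_⟩
  have hp : IsProbabilityMeasure ((gaussVec ι v).map (fun x : ι → ℝ => B *ᵥ x)) :=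
    Measure.isProbabilityMeasure_map hm.aemeasurable
  simp only [MeasurableEquiv.coe_toLp]
  have h1 : IsProbabilityMeasure (((gaussVec ι v).map (fun x : ι → ℝ => B *ᵥ x)).map
    (WithLp.toLp 2)) := Measure.isProbabilityMeasure_map (by fun_prop)
  have h2 : IsProbabilityMeasure ((gaussVec κ v).map (WithLp.toLp 2)) :=
    Measure.isProbabilityMeasure_map (by fun_prop)
  refine Measure.ext_of_charFun (E := EuclideanSpace ℝ κ) (funext fun t => ?_)
  have h3 : charFun (((gaussVec ι v).map (fun x : ι → ℝ => B *ᵥ x)).map (WithLp.toLp 2)) t =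
      charFun ((gaussVec ι v).map (WithLp.toLp 2)) (WithLp.toLp 2 (Bᵀ *ᵥ t.ofLp)) := by
    rw [charFun_apply, charFun_apply, Measure.map_map (by fun_prop) hm,
      integral_map (by fun_prop) (by fun_prop), integral_map (by fun_prop) (by fun_prop)]
    congr 1
    ext x
    congr 3
    simp only [Function.comp_apply, EuclideanSpace.inner_eq_star_dotProduct, star_trivial]
    rw [dotProduct_mulVec, mulVec_transpose]
  rw [h3, charFun_gaussVec, charFun_gaussVec]
  have h4 : ∑ i, (Bᵀ *ᵥ t.ofLp) i ^ 2 = ∑ i, t i ^ 2 := by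
    have : (Bᵀ *ᵥ t.ofLp) ⬝ᵥ (Bᵀ *ᵥ t.ofLp) = t.ofLp ⬝ᵥ t.ofLp := by
      rw [dotProduct_mulVec, vecMul_transpose, mulVec_mulVec, hB, one_mulVec]
    simpa [dotProduct, sq] using this
  simp only [h4]

end GaussianVectors

lemma measurePreserving_curry_gaussVec (κ ι : Type*) [Fintype κ] [Fintype ι] (v : NNReal) :
    MeasurePreserving (MeasurableEquiv.curry κ ι ℝ) (gaussVec (κ × ι) v) (gaussArray κ ι v) := by
  refine ⟨(MeasurableEquiv.curry κ ι ℝ).measurable, ?_⟩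
  have := Measure.infinitePi_map_curry (fun (_ : κ) (_ : ι) => gaussianReal 0 v)
  simpa only [Measure.infinitePi_eq_pi] using this

/-- Transposing an array of i.i.d. Gaussian entries preserves its law. -/
lemma measurePreserving_transpose (κ ι : Type*) [Fintype κ] [Fintype ι] (v : NNReal) :
    MeasurePreserving (fun (X : κ → ι → ℝ) i k => X k i)
      (gaussArray κ ι v) (gaussArray ι κ v) := by
  have h2 := measurePreserving_piCongrLeft (fun _ : ι × κ => gaussianReal 0 v)
    (Equiv.prodComm κ ι)
  have h3 := (measurePreserving_curry_gaussVec ι κ v).comp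
    (h2.comp (measurePreserving_curry_gaussVec κ ι v).symm)
  refine (congrArg (fun f => MeasurePreserving f (gaussArray κ ι v) (gaussArray ι κ v)) ?_).mp h3
  rfl

/-- For real `s > 0`, the Laplace transform of a squared Gaussian. -/
lemma integral_exp_neg_mul_sq_gaussianReal {v : NNReal} (hv : v ≠ 0) {t : ℝ} (ht : 0 ≤ t) :
    ∫ x, Real.exp (-(t * x ^ 2)) ∂(gaussianReal 0 v) = (Real.sqrt (1 + 2 * v * t))⁻¹ := by
  have hv' : (0 : ℝ) < v := by positivity
  rw [integral_gaussianReal_eq_integral_smul hv]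
  simp only [gaussianPDFReal, smul_eq_mul, sub_zero]
  have : ∀ x : ℝ, (√(2 * Real.pi * v))⁻¹ * Real.exp (-x ^ 2 / (2 * v)) * Real.exp (-(t * x ^ 2))
      = (√(2 * Real.pi * v))⁻¹ * Real.exp (-(1 / (2 * v) + t) * x ^ 2) := by
    intro x
    rw [mul_assoc, ← Real.exp_add]
    congr 2
    field_simp
    ring
  simp_rw [this]
  rw [integral_const_mul, integral_gaussian, ← Real.sqrt_inv, ← Real.sqrt_inv, ← Real.sqrt_mul
    (by positivity)]
  congr 1
  field_simp

lemma lintegral_exp_neg_mul_sum_sq {ι : Type*} [Fintype ι] {v : NNReal} (hv : v ≠ 0) {t : ℝ}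
    (ht : 0 ≤ t) :
    ∫⁻ x, ENNReal.ofReal (Real.exp (-(t * ∑ i, x i ^ 2))) ∂(gaussVec ι v) =
      ENNReal.ofReal ((1 + 2 * v * t) ^ (-(Fintype.card ι : ℝ) / 2)) := by
  rw [← ofReal_integral_eq_lintegral_ofReal]
  · congr 1
    have : ∀ x : ι → ℝ, Real.exp (-(t * ∑ i, x i ^ 2)) = ∏ i, Real.exp (-(t * x i ^ 2)) := by
      intro x
      rw [← Real.exp_sum, Finset.mul_sum, Finset.sum_neg_distrib]
    simp_rw [this]
    rw [integral_fintype_prod_eq_pow (fun x : ℝ => Real.exp (-(t * x ^ 2))),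
      integral_exp_neg_mul_sq_gaussianReal hv ht, Real.sqrt_eq_rpow,
      ← Real.rpow_neg (by positivity),
      ← Real.rpow_natCast, ← Real.rpow_mul (by positivity)]
    congr 1
    ring
  · refine Integrable.of_bound (C := 1) (by
      exact (by fun_prop : Continuous fun x : ι → ℝ =>
        Real.exp (-(t * ∑ i, x i ^ 2))).aestronglyMeasurable) (ae_of_all _ fun x => ?_)
    rw [Real.norm_eq_abs, Real.abs_exp, Real.exp_le_one_iff, neg_nonpos]
    positivity
  · exact ae_of_all _ fun x => by positivity

/-- The first inverse moment of the squared norm of a white Gaussian vector. -/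
lemma lintegral_inv_sum_sq {ι : Type*} [Fintype ι] (hι : 2 < Fintype.card ι) {v : NNReal}
    (hv : v ≠ 0) :
    ∫⁻ x, ENNReal.ofReal ((∑ i, x i ^ 2)⁻¹) ∂(gaussVec ι v) =
      ENNReal.ofReal ((v * (Fintype.card ι - 2 : ℝ))⁻¹) := by
  have hv' : (0 : ℝ) < v := by positivity
  have hn : (2 : ℝ) < Fintype.card ι := by exact_mod_cast hι
  have hne : ∀ᵐ x ∂(gaussVec ι v), ∑ i, x i ^ 2 ≠ 0 := by
    obtain ⟨i⟩ : Nonempty ι := Fintype.card_pos_iff.mp (by omega)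
    have hz : gaussVec ι v {0} = 0 := by
      have := nullSingletonClass_gaussianReal (μ := 0) hv
      rw [gaussVec, Measure.pi_singleton]
      exact Finset.prod_eq_zero (Finset.mem_univ i) (measure_singleton _)
    filter_upwards [compl_mem_ae_iff.mpr hz] with x hx h0
    refine hx (funext fun j => ?_)
    have := (Finset.sum_eq_zero_iff_of_nonneg (fun j _ => sq_nonneg (x j))).mp h0 j
      (Finset.mem_univ j)
    simpa using this
  have h1 : ∫⁻ x, ENNReal.ofReal ((∑ i, x i ^ 2)⁻¹) ∂(gaussVec ι v) =
      ∫⁻ x, (∫⁻ t in Set.Ioi (0 : ℝ), ENNReal.ofReal (Real.exp (-(t * ∑ i, x i ^ 2))))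
        ∂(gaussVec ι v) := by
    refine lintegral_congr_ae ?_
    filter_upwards [hne] with x hx
    have hpos : 0 < ∑ i, x i ^ 2 := lt_of_le_of_ne (by positivity) (Ne.symm hx)
    have hi : IntegrableOn (fun t : ℝ => Real.exp (-(∑ i, x i ^ 2) * t)) (Set.Ioi 0) :=
      integrableOn_exp_mul_Ioi (neg_lt_zero.mpr hpos) 0
    have he := integral_exp_mul_Ioi (neg_lt_zero.mpr hpos) 0
    rw [← ofReal_integral_eq_lintegral_ofReal]
    · congr 1
      simp only [mul_comm _ (∑ i, x i ^ 2), ← neg_mul]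
      rw [he]
      simp
    · simpa only [mul_comm _ (∑ i, x i ^ 2), ← neg_mul, IntegrableOn] using hi
    · exact ae_of_all _ fun t => by positivity
  rw [h1, lintegral_lintegral_swap (by fun_prop)]
  have h2 : ∫⁻ t in Set.Ioi (0 : ℝ), ∫⁻ x, ENNReal.ofReal (Real.exp (-(t * ∑ i, x i ^ 2)))
        ∂(gaussVec ι v) = ∫⁻ t in Set.Ioi (0 : ℝ),
        ENNReal.ofReal ((1 + 2 * v * t) ^ (-(Fintype.card ι : ℝ) / 2)) :=
    setLIntegral_congr_fun measurableSet_Ioi fun t ht =>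
      lintegral_exp_neg_mul_sum_sq hv (le_of_lt ht)
  set a : ℝ := -(Fintype.card ι : ℝ) / 2 with ha
  have ha1 : a + 1 < 0 := by rw [ha]; linarith
  have hd : ∀ t ∈ Set.Ici (0 : ℝ), HasDerivAt
      (fun t : ℝ => (1 + 2 * v * t) ^ (a + 1) / (2 * v * (a + 1))) ((1 + 2 * v * t) ^ a) t := by
    intro t ht
    have ht' : (0 : ℝ) ≤ t := ht
    have hb : HasDerivAt (fun t : ℝ => 1 + 2 * v * t) (2 * v) t := by
      simpa using ((hasDerivAt_id t).const_mul (2 * (v : ℝ))).const_add 1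
    have := (hb.rpow_const (p := a + 1) (Or.inl (by positivity))).div_const (2 * v * (a + 1))
    refine this.congr_deriv ?_
    rw [add_sub_cancel_right]
    field_simp [ha1.ne]
  have hnn : ∀ t ∈ Set.Ioi (0 : ℝ), 0 ≤ (1 + 2 * v * t) ^ a := by
    intro t ht
    have : (0 : ℝ) < t := ht
    positivity
  have hlim : Tendsto (fun t : ℝ => (1 + 2 * v * t) ^ (a + 1) / (2 * v * (a + 1))) atTop
      (nhds 0) := by
    have h3 : Tendsto (fun t : ℝ => 1 + 2 * v * t) atTop atTop :=
      tendsto_atTop_add_const_left _ _ (tendsto_id.const_mul_atTop (by positivity))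
    have h4 := (tendsto_rpow_neg_atTop (y := -(a + 1)) (by linarith)).comp h3
    simpa [Function.comp_def] using h4.div_const (2 * v * (a + 1))
  rw [h2, ← ofReal_integral_eq_lintegral_ofReal
    (integrableOn_Ioi_deriv_of_nonneg' hd hnn hlim)
    ((ae_restrict_iff' measurableSet_Ioi).mpr (ae_of_all _ hnn)),
    integral_Ioi_of_hasDerivAt_of_nonneg' hd hnn hlim]
  congr 1
  simp only [mul_zero, add_zero, Real.one_rpow, zero_sub, ha]
  have : (Fintype.card ι : ℝ) - 2 ≠ 0 := by linarith
  rw [show -(Fintype.card ι : ℝ) / 2 + 1 = -((Fintype.card ι : ℝ) - 2) / 2 by ring]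
  field_simp

/-- The orthogonal complement of `k` linearly independent vectors of `ℝⁿ`, in coordinates. -/
lemma exists_orthonormal_rows_orthogonal {k n : ℕ} (w : Fin k → Fin n → ℝ)
    (hw : LinearIndependent ℝ w) :
    ∃ B : Matrix (Fin (n - k)) (Fin n) ℝ, B * Bᵀ = 1 ∧ (∀ i, B *ᵥ w i = 0) ∧
      ∀ x, (∀ i, w i ⬝ᵥ x = 0) → Bᵀ *ᵥ (B *ᵥ x) = x := by
  let L : (Fin n → ℝ) ≃ₗ[ℝ] EuclideanSpace ℝ (Fin n) := (WithLp.linearEquiv 2 ℝ (Fin n → ℝ)).symm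
  have hLw : LinearIndependent ℝ (fun i => L (w i)) := hw.map' L.toLinearMap L.ker
  let K : Submodule ℝ (EuclideanSpace ℝ (Fin n)) := Submodule.span ℝ (Set.range fun i => L (w i))
  have hK : Module.finrank ℝ K = k := by
    simpa using finrank_span_eq_card hLw
  have hKo : Module.finrank ℝ Kᗮ = n - k := by
    have := K.finrank_add_finrank_orthogonal
    rw [hK, finrank_euclideanSpace_fin] at this
    omega
  let b : OrthonormalBasis (Fin (n - k)) ℝ Kᗮ := (stdOrthonormalBasis ℝ Kᗮ).reindex
    (finCongr hKo)
  have hmul : ∀ (x : Fin n → ℝ) (i : Fin (n - k)),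
      ((Matrix.of fun i j => (b i : EuclideanSpace ℝ (Fin n)) j) *ᵥ x) i =
        inner ℝ (b i : EuclideanSpace ℝ (Fin n)) (L x) := by
    intro x i
    rw [EuclideanSpace.inner_eq_star_dotProduct]
    simp only [mulVec, star_trivial]
    rw [dotProduct_comm]
    rfl
  refine ⟨Matrix.of fun i j => (b i : EuclideanSpace ℝ (Fin n)) j, ?_, ?_, ?_⟩
  · ext i j
    have := orthonormal_iff_ite.mp b.orthonormal j i
    rw [Submodule.coe_inner, EuclideanSpace.inner_eq_star_dotProduct] at this
    rw [Matrix.one_apply]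
    simp only [@eq_comm _ i j]
    rw [← this]
    rfl
  · intro i
    ext l
    rw [hmul]
    exact (Submodule.mem_orthogonal' K _).mp (b l).2 _
      (Submodule.subset_span (Set.mem_range_self i))
  · intro x hx
    have hxK : L x ∈ Kᗮ := by
      rw [Submodule.mem_orthogonal']
      intro u hu
      induction hu using Submodule.span_induction with
      | mem u hu =>
        obtain ⟨i, rfl⟩ := hu
        rw [EuclideanSpace.inner_eq_star_dotProduct]
        simp only [star_trivial]
        exact hx i
      | zero => simp
      | add u v _ _ hu hv => rw [inner_add_right, hu, hv, add_zero]
      | smul a u _ hu => rw [inner_smul_right, hu, mul_zero]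
    have hsum := b.sum_repr' ⟨L x, hxK⟩
    have hsum' : ∑ i, inner ℝ (b i : EuclideanSpace ℝ (Fin n)) (L x) •
        (b i : EuclideanSpace ℝ (Fin n)) = L x := by
      simpa using congrArg (Subtype.val) hsum
    ext j
    have hj := congrArg (fun y : EuclideanSpace ℝ (Fin n) => y j) hsum'
    simp only [mulVec_transpose, vecMul, dotProduct, hmul, Matrix.of_apply]
    refine Eq.trans ?_ hj
    simp

lemma det_mul_transpose_ne_zero_iff {k n : ℕ} (X : Fin k → Fin n → ℝ) :
    (Matrix.of X * (Matrix.of X)ᵀ).det ≠ 0 ↔ LinearIndependent ℝ X := by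
  have hps : (Matrix.of X * (Matrix.of X)ᵀ).PosSemidef := by
    simpa using posSemidef_self_mul_conjTranspose (Matrix.of X)
  constructor
  · intro h
    rw [Fintype.linearIndependent_iff]
    intro g hg
    have hv : g ᵥ* Matrix.of X = 0 := by
      rw [← hg]
      ext j
      simp [vecMul, dotProduct]
    have := eq_zero_of_vecMul_eq_zero h (v := g) (by rw [← vecMul_vecMul, hv, zero_vecMul])
    exact fun i => congrFun this i
  · intro h
    have hinj : Function.Injective (Matrix.of X).vecMul :=
      Matrix.vecMul_injective_iff.mpr h
    have := PosDef.mul_conjTranspose_self (Matrix.of X) hinj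
    exact (by simpa using this.det_pos.ne' : (Matrix.of X * (Matrix.of X)ᵀ).det ≠ 0)

lemma continuous_gram (k n : ℕ) :
    Continuous fun X : Fin k → Fin n → ℝ => Matrix.of X * (Matrix.of X)ᵀ := by
  have h : Continuous fun X : Fin k → Fin n → ℝ => Matrix.of X := continuous_id
  exact h.matrix_mul h.matrix_transpose

lemma measurable_gram_inv_apply {k n : ℕ} (i j : Fin k) :
    Measurable fun X : Fin k → Fin n → ℝ => (Matrix.of X * (Matrix.of X)ᵀ)⁻¹ i j := by
  have h := continuous_gram k n
  simp only [Matrix.inv_def, Matrix.smul_apply, Ring.inverse_eq_inv', smul_eq_mul]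
  exact h.matrix_det.measurable.inv.mul (h.matrix_adjugate.matrix_elem i j).measurable

/-- A white Gaussian vector is almost surely outside the kernel of a matrix with orthonormal
rows. -/
lemma ae_mulVec_ne_zero {ι κ : Type*} [Fintype ι] [Fintype κ] [DecidableEq κ] [Nonempty κ]
    {v : NNReal} (hv : v ≠ 0) (B : Matrix κ ι ℝ) (hB : B * Bᵀ = 1) :
    ∀ᵐ x ∂(gaussVec ι v), B *ᵥ x ≠ 0 := by
  have hz : gaussVec κ v {0} = 0 := by
    have := nullSingletonClass_gaussianReal (μ := 0) hv
    rw [gaussVec, Measure.pi_singleton]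
    exact Finset.prod_eq_zero (Finset.mem_univ (Classical.arbitrary κ)) (measure_singleton _)
  exact (measurePreserving_mulVec B hB).quasiMeasurePreserving.ae (compl_mem_ae_iff.mpr hz)

/-- At most `n` independent white Gaussian vectors in `ℝⁿ` are almost surely linearly
independent. -/
lemma ae_linearIndependent_gaussArray {n : ℕ} {v : NNReal} (hv : v ≠ 0) :
    ∀ k ≤ n, ∀ᵐ X ∂(gaussArray (Fin k) (Fin n) v), LinearIndependent ℝ X := by
  intro k
  induction k with
  | zero => exact fun _ => ae_of_all _ fun X => linearIndependent_empty_type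
  | succ k ih =>
    intro hk
    have hmp := measurePreserving_piFinSuccAbove (fun _ : Fin (k + 1) => gaussVec (Fin n) v) 0
    have hmeas : MeasurableSet {X : Fin (k + 1) → Fin n → ℝ | LinearIndependent ℝ X} := by
      simp_rw [← det_mul_transpose_ne_zero_iff]
      exact (isOpen_ne.preimage (continuous_gram (k + 1) n).matrix_det).measurableSet
    have hmeas' : MeasurableSet {p : (Fin k → Fin n → ℝ) × (Fin n → ℝ) |
        LinearIndependent ℝ (Fin.cons p.2 p.1 : Fin (k + 1) → Fin n → ℝ)} := by
      have := ((MeasurableEquiv.piFinSuccAbove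
        (fun _ : Fin (k + 1) => Fin n → ℝ) 0).symm.measurable.comp
        measurable_swap) hmeas
      convert this using 1
      ext p
      change _ ↔ LinearIndependent ℝ (Fin.insertNth 0 p.2 p.1 : Fin (k + 1) → Fin n → ℝ)
      rw [Fin.insertNth_zero']
      rfl
    have key : ∀ᵐ p ∂((gaussArray (Fin k) (Fin n) v).prod (gaussVec (Fin n) v)),
        LinearIndependent ℝ (Fin.cons p.2 p.1 : Fin (k + 1) → Fin n → ℝ) := by
      rw [Measure.ae_prod_iff_ae_ae hmeas']
      filter_upwards [ih (by omega)] with w hw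
      obtain ⟨B, hB, hBw, -⟩ := exists_orthonormal_rows_orthogonal w hw
      have : Nonempty (Fin (n - k)) := ⟨⟨0, by omega⟩⟩
      filter_upwards [ae_mulVec_ne_zero hv B hB] with x hx
      refine linearIndependent_finCons.mpr ⟨hw, fun hmem => hx ?_⟩
      have hle : Submodule.span ℝ (Set.range w) ≤ LinearMap.ker B.mulVecLin := by
        rw [Submodule.span_le]
        rintro _ ⟨i, rfl⟩
        exact hBw i
      exact hle hmem
    have h2 := (Measure.measurePreserving_swap.comp hmp).quasiMeasurePreserving.ae key
    filter_upwards [h2] with X hX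
    have : (Fin.cons (X 0) (fun j => X (Fin.succ j)) : Fin (k + 1) → Fin n → ℝ) = X :=
      Fin.cons_self_tail X
    rw [← this]
    exact hX

/-- The diagonal entries of an inverse Gram matrix are the inverse squared distances of each
vector to the span of the others. -/
lemma gram_inv_apply_self {k n m : ℕ} (X : Fin (k + 1) → Fin n → ℝ)
    (hX : (Matrix.of X * (Matrix.of X)ᵀ).det ≠ 0) (j : Fin (k + 1))
    (B : Matrix (Fin m) (Fin n) ℝ) (hBw : ∀ i, B *ᵥ X (j.succAbove i) = 0)
    (hBx : ∀ x, (∀ i, X (j.succAbove i) ⬝ᵥ x = 0) → Bᵀ *ᵥ (B *ᵥ x) = x) :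
    (Matrix.of X * (Matrix.of X)ᵀ)⁻¹ j j = (∑ i, (B *ᵥ X j) i ^ 2)⁻¹ := by
  set A : Matrix (Fin (k + 1)) (Fin n) ℝ := Matrix.of X with hA
  set y : Fin (k + 1) → ℝ := (A * Aᵀ)⁻¹ *ᵥ Pi.single j 1 with hy
  have hyj : (A * Aᵀ)⁻¹ j j = y j := by simp [hy]
  have hyA : A *ᵥ (Aᵀ *ᵥ y) = Pi.single j 1 := by
    rw [mulVec_mulVec, hy, mulVec_mulVec, Matrix.mul_nonsing_inv _ (Ne.isUnit hX), one_mulVec]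
  have hdot : ∀ i, X i ⬝ᵥ (Aᵀ *ᵥ y) = (Pi.single j 1 : Fin (k + 1) → ℝ) i :=
    fun i => congrFun hyA i
  have hB1 : B *ᵥ (Aᵀ *ᵥ y) = y j • (B *ᵥ X j) := by
    have : Aᵀ *ᵥ y = ∑ i, y i • X i := by
      ext l
      simp [mulVec, dotProduct, hA, mul_comm]
    rw [this, Fin.sum_univ_succAbove _ j, mulVec_add, mulVec_smul, mulVec_sum]
    simp [mulVec_smul, hBw]
  have hB2 : Bᵀ *ᵥ (B *ᵥ (Aᵀ *ᵥ y)) = Aᵀ *ᵥ y :=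
    hBx _ fun i => by rw [hdot]; simp
  have h1 : y j * ∑ i, (B *ᵥ X j) i ^ 2 = 1 := by
    have h2 := hdot j
    rw [← hB2, dotProduct_mulVec, vecMul_transpose, hB1, dotProduct_smul] at h2
    simpa [dotProduct, sq] using h2
  rw [hyj]
  exact eq_inv_of_mul_eq_one_left h1

lemma lintegral_gram_inv_apply_self {k n : ℕ} (hkn : k + 2 < n) {v : NNReal} (hv : v ≠ 0)
    (j : Fin k) :
    ∫⁻ X, ENNReal.ofReal ((Matrix.of X * (Matrix.of X)ᵀ)⁻¹ j j) ∂(gaussArray (Fin k) (Fin n) v) =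
      ENNReal.ofReal ((v * (n - k - 1 : ℝ))⁻¹) := by
  obtain ⟨k, rfl⟩ : ∃ l, k = l + 1 := ⟨k - 1, by have := j.pos; omega⟩
  have hmp := (measurePreserving_piFinSuccAbove
    (fun _ : Fin (k + 1) => gaussVec (Fin n) v) j).symm
  have hf := (measurable_gram_inv_apply (n := n) j j).ennreal_ofReal
  have hae := hmp.quasiMeasurePreserving.ae
    (ae_linearIndependent_gaussArray hv (k + 1) (by omega : k + 1 ≤ n))
  rw [gaussArray, ← hmp.lintegral_comp hf]
  refine (lintegral_prod_symm _ ((hf.comp hmp.measurable).aemeasurable)).trans ?_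
  have hae' := Measure.ae_ae_of_ae_prod
    (Measure.measurePreserving_swap.quasiMeasurePreserving.ae hae)
  have hconst : ∀ᵐ w ∂(gaussArray (Fin k) (Fin n) v),
      ∫⁻ x, ENNReal.ofReal ((Matrix.of (Fin.insertNth j x w : Fin (k + 1) → Fin n → ℝ) *
        (Matrix.of (Fin.insertNth j x w : Fin (k + 1) → Fin n → ℝ))ᵀ)⁻¹ j j)
          ∂(gaussVec (Fin n) v) = ENNReal.ofReal ((v * (n - (k + 1 : ℕ) - 1 : ℝ))⁻¹) := by
    filter_upwards [hae', ae_linearIndependent_gaussArray hv k (by omega : k ≤ n)] with w hw hli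
    obtain ⟨B, hB, hBw, hBx⟩ := exists_orthonormal_rows_orthogonal w hli
    have h1 : ∀ᵐ x ∂(gaussVec (Fin n) v),
        ENNReal.ofReal ((Matrix.of (Fin.insertNth j x w : Fin (k + 1) → Fin n → ℝ) *
        (Matrix.of (Fin.insertNth j x w : Fin (k + 1) → Fin n → ℝ))ᵀ)⁻¹ j j) =
        ENNReal.ofReal ((∑ i, (B *ᵥ x) i ^ 2)⁻¹) := by
      filter_upwards [hw] with x hx
      rw [gram_inv_apply_self (Fin.insertNth j x w : Fin (k + 1) → Fin n → ℝ)
        ((det_mul_transpose_ne_zero_iff _).mpr hx) j B (by simpa using hBw) (by simpa using hBx)]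
      simp
    rw [lintegral_congr_ae h1]
    have h2 := (measurePreserving_mulVec (v := v) B hB).lintegral_comp
      (f := fun x => ENNReal.ofReal ((∑ i, x i ^ 2)⁻¹)) (by fun_prop)
    rw [h2, lintegral_inv_sum_sq (by rw [Fintype.card_fin]; omega) hv, Fintype.card_fin,
      Nat.cast_sub (by omega)]
    congr 3
    push_cast
    ring
  refine (lintegral_congr_ae hconst).trans ?_
  simp

/-- Flipping signs of entries preserves the law of an array of i.i.d. centered Gaussians. -/
lemma measurePreserving_sign_mul {κ ι : Type*} [Fintype κ] [Fintype ι] {v : NNReal}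
    (ε : κ → ι → ℝ) (hε : ∀ k i, ε k i * ε k i = 1) :
    MeasurePreserving (fun (X : κ → ι → ℝ) k i => ε k i * X k i)
      (gaussArray κ ι v) (gaussArray κ ι v) := by
  classical
  have := measurePreserving_pi (fun _ : κ => gaussVec ι v) (fun _ : κ => gaussVec ι v)
    (f := fun k x => diagonal (ε k) *ᵥ x) fun k => measurePreserving_mulVec (diagonal (ε k)) (by
      rw [diagonal_transpose, diagonal_mul_diagonal, ← diagonal_one]
      exact congrArg diagonal (funext (hε k)))
  have h : (fun (X : κ → ι → ℝ) k i => ε k i * X k i) = fun X k => diagonal (ε k) *ᵥ X k := by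
    ext
    simp [mulVec_diagonal]
  rw [h]
  exact this

lemma integral_eq_zero_of_comp_eq_neg {α : Type*} [MeasurableSpace α] {μ : Measure α} {f : α → α}
    (hf : MeasurePreserving f μ μ) {g : α → ℝ} (hg : Measurable g) (h : ∀ x, g (f x) = -g x) :
    ∫ x, g x ∂μ = 0 := by
  have h1 : ∫ x, g (f x) ∂μ = ∫ x, g x ∂μ := by
    conv_rhs => rw [← hf.map_eq]
    rw [integral_map hf.measurable.aemeasurable hg.aestronglyMeasurable]
  simp_rw [h, integral_neg] at h1
  linarith

section Moments

variable {κ ι : Type*} [Fintype κ] [Fintype ι] {v : NNReal}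

lemma measurePreserving_gaussArray_apply (k : κ) (a : ι) :
    MeasurePreserving (fun X : κ → ι → ℝ => X k a) (gaussArray κ ι v) (gaussianReal 0 v) :=
  (measurePreserving_eval (fun _ : ι => gaussianReal 0 v) a).comp
    (measurePreserving_eval (fun _ : κ => gaussVec ι v) k)

lemma memLp_gaussArray_apply (k : κ) (a : ι) :
    MemLp (fun X : κ → ι → ℝ => X k a) 2 (gaussArray κ ι v) :=
  (memLp_id_gaussianReal 2).comp_measurePreserving (measurePreserving_gaussArray_apply k a)

lemma integrable_gaussArray_apply (k : κ) (a : ι) :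
    Integrable (fun X : κ → ι → ℝ => X k a) (gaussArray κ ι v) :=
  (memLp_gaussArray_apply k a).integrable (by norm_num)

lemma integrable_gaussArray_apply_mul (k l : κ) (a b : ι) :
    Integrable (fun X : κ → ι → ℝ => X k a * X l b) (gaussArray κ ι v) :=
  (memLp_gaussArray_apply k a).integrable_mul (memLp_gaussArray_apply l b)

lemma integral_gaussArray_apply (k : κ) (a : ι) :
    ∫ X, X k a ∂(gaussArray κ ι v) = 0 :=
  integral_eq_zero_of_comp_eq_neg
    (measurePreserving_sign_mul (fun _ _ => -1) (by simp)) (g := fun X => X k a) (by fun_prop)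
    (by simp)

lemma integral_gaussArray_apply_mul [DecidableEq κ] [DecidableEq ι] (k l : κ) (a b : ι) :
    ∫ X, X k a * X l b ∂(gaussArray κ ι v) = if k = l ∧ a = b then (v : ℝ) else 0 := by
  split_ifs with h
  · obtain ⟨rfl, rfl⟩ := h
    have h1 : ∫ x, x ^ 2 ∂(gaussianReal 0 v) = v := by
      have := variance_fun_id_gaussianReal (μ := 0) (v := v)
      rwa [variance_of_integral_eq_zero (by fun_prop) (by simp)] at this
    have h2 := measurePreserving_gaussArray_apply (v := v) k a
    rw [← h1, ← h2.map_eq, integral_map h2.measurable.aemeasurable (by fun_prop)]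
    simp only [sq]
  · refine integral_eq_zero_of_comp_eq_neg (measurePreserving_sign_mul
      (fun k' a' => if k' = k ∧ a' = a then -1 else 1) (fun k' a' => ?_))
      (g := fun X => X k a * X l b) (by fun_prop) fun X => ?_
    · split_ifs <;> norm_num
    · have h' : ¬ (l = k ∧ b = a) := fun hh => h ⟨hh.1.symm, hh.2.symm⟩
      simp only [and_self, if_true, if_neg h']
      ring

end Moments

lemma posSemidef_gram_inv {k n : ℕ} (X : Fin k → Fin n → ℝ) :
    (Matrix.of X * (Matrix.of X)ᵀ)⁻¹.PosSemidef := by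
  have : (Matrix.of X * (Matrix.of X)ᵀ).PosSemidef := by
    simpa using posSemidef_self_mul_conjTranspose (Matrix.of X)
  exact this.inv

lemma abs_apply_le_of_posSemidef {ι : Type*} [Fintype ι] {M : Matrix ι ι ℝ}
    (hM : M.PosSemidef) (i j : ι) : |M i j| ≤ M i i + M j j := by
  classical
  have hsymm : M j i = M i j := by simpa using hM.isHermitian.apply i j
  have h1 := hM.dotProduct_mulVec_nonneg (Pi.single i 1 + Pi.single j 1)
  have h2 := hM.dotProduct_mulVec_nonneg (Pi.single i 1 - Pi.single j 1)
  have hi := hM.diag_nonneg (i := i)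
  have hj := hM.diag_nonneg (i := j)
  simp only [star_trivial, mulVec_add, mulVec_sub, add_dotProduct, sub_dotProduct, dotProduct_add,
    dotProduct_sub, mulVec_single_one, single_dotProduct, one_mul, Matrix.col_apply] at h1 h2
  rw [abs_le]
  constructor <;> linarith

/-- The mean of an inverse Wishart matrix. -/
lemma integrable_and_integral_gram_inv_apply {k n : ℕ} (hkn : k + 2 < n) {v : NNReal} (hv : v ≠ 0)
    (i j : Fin k) :
    Integrable (fun X => (Matrix.of X * (Matrix.of X)ᵀ)⁻¹ i j) (gaussArray (Fin k) (Fin n) v) ∧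
      ∫ X, (Matrix.of X * (Matrix.of X)ᵀ)⁻¹ i j ∂(gaussArray (Fin k) (Fin n) v) =
        if i = j then (v * (n - k - 1 : ℝ))⁻¹ else 0 := by
  have hpos : 0 ≤ (v * (n - k - 1 : ℝ))⁻¹ := by
    have : (k + 2 : ℝ) < n := by exact_mod_cast hkn
    have : (0 : ℝ) ≤ n - k - 1 := by linarith
    positivity
  have hnn : ∀ (i : Fin k) (X : Fin k → Fin n → ℝ),
      0 ≤ (Matrix.of X * (Matrix.of X)ᵀ)⁻¹ i i := fun i X => (posSemidef_gram_inv X).diag_nonneg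
  have hdiag : ∀ i, Integrable (fun X => (Matrix.of X * (Matrix.of X)ᵀ)⁻¹ i i)
      (gaussArray (Fin k) (Fin n) v) := by
    intro i
    rw [← lintegral_ofReal_ne_top_iff_integrable
      (measurable_gram_inv_apply i i).aestronglyMeasurable (ae_of_all _ (hnn i)),
      lintegral_gram_inv_apply_self hkn hv]
    exact ENNReal.ofReal_ne_top
  refine ⟨((hdiag i).add (hdiag j)).mono' (measurable_gram_inv_apply i j).aestronglyMeasurable
    (ae_of_all _ fun X => abs_apply_le_of_posSemidef (posSemidef_gram_inv X) i j), ?_⟩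
  split_ifs with h
  · subst h
    rw [integral_eq_lintegral_of_nonneg_ae (ae_of_all _ (hnn i))
      (measurable_gram_inv_apply i i).aestronglyMeasurable, lintegral_gram_inv_apply_self hkn hv,
      ENNReal.toReal_ofReal hpos]
  · set ε : Fin k → ℝ := fun l => if l = i then -1 else 1 with hε
    have hε1 : ∀ l, ε l * ε l = 1 := by
      intro l
      simp only [hε]
      split_ifs <;> norm_num
    refine integral_eq_zero_of_comp_eq_neg
      (measurePreserving_sign_mul (fun l _ => ε l) fun l _ => hε1 l)
      (measurable_gram_inv_apply i j) fun X => ?_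
    have h1 : Matrix.of (fun l a => ε l * X l a) = diagonal ε * Matrix.of X := by
      ext l a
      simp [diagonal_mul]
    have h2 : (diagonal ε)⁻¹ = diagonal ε := by
      refine Matrix.inv_eq_right_inv ?_
      rw [diagonal_mul_diagonal, ← diagonal_one]
      exact congrArg diagonal (funext hε1)
    rw [h1, transpose_mul, diagonal_transpose, Matrix.mul_assoc, ← Matrix.mul_assoc (Matrix.of X),
      Matrix.mul_inv_rev, Matrix.mul_inv_rev, h2, mul_diagonal, diagonal_mul]
    have h3 : ε i = -1 := by simp [hε]
    have h4 : ε j = 1 := by simp [hε, Ne.symm h]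
    rw [h3, h4]
    ring

/-- With `U'` completing `U` to an orthogonal matrix, `K₁` is `Σ⁻²` plus a quadratic form in the
inverse of the Gram matrix of `U'ᵀ A`. -/
lemma K1mat_eq {d N r m : ℕ} (A : Matrix (Fin d) (Fin N) ℝ) (U : Matrix (Fin d) (Fin r) ℝ)
    (U' : Matrix (Fin d) (Fin m) ℝ) (V : Matrix (Fin N) (Fin r) ℝ) (S : Matrix (Fin r) (Fin r) ℝ)
    (hS : Sᵀ = S) (hSdet : IsUnit S.det) (hU : Uᵀ * U = 1) (hUU' : U * Uᵀ + U' * U'ᵀ = 1)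
    (hW : (Aᵀ * U' * (Aᵀ * U')ᵀ).det ≠ 0) :
    K1mat A U V S = S⁻¹ * S⁻¹ + (Vᵀ + S⁻¹ * (Aᵀ * U)ᵀ) * (Aᵀ * U' * (Aᵀ * U')ᵀ)⁻¹ *
      (V + Aᵀ * U * S⁻¹) := by
  set C := Aᵀ * U with hC
  set W := Aᵀ * U' * (Aᵀ * U')ᵀ with hWdef
  have hG : Aᵀ * A = C * Cᵀ + W := by
    calc Aᵀ * A = Aᵀ * (U * Uᵀ + U' * U'ᵀ) * A := by rw [hUU', Matrix.mul_one]
      _ = _ := by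
        rw [hC, hWdef, Matrix.mul_add, Matrix.add_mul, transpose_mul, transpose_mul,
          transpose_transpose]
        simp only [Matrix.mul_assoc]
  have hWsymm : Wᵀ = W := by rw [hWdef, transpose_mul, transpose_transpose]
  have hWps : W.PosSemidef := by
    have := posSemidef_self_mul_conjTranspose (Aᵀ * U')
    rwa [conjTranspose_eq_transpose_of_trivial] at this
  have hWpd : W.PosDef := hWps.posDef_iff_det_ne_zero.mpr hW
  have hGpd : (C * Cᵀ + W).PosDef := by
    refine hWpd.posSemidef_add ?_
    simpa using posSemidef_self_mul_conjTranspose C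
  have hGdet : IsUnit (C * Cᵀ + W).det := hGpd.det_pos.ne'.isUnit
  have hWdet : IsUnit W.det := hW.isUnit
  set M := (C * Cᵀ + W)⁻¹ with hM
  have hMsymm : Mᵀ = M := by
    rw [hM, transpose_nonsing_inv, transpose_add, transpose_mul, transpose_transpose, hWsymm]
  have hWisymm : (W⁻¹)ᵀ = W⁻¹ := by rw [transpose_nonsing_inv, hWsymm]
  have hTsymm : (S⁻¹)ᵀ = S⁻¹ := by rw [transpose_nonsing_inv, hS]
  have hpinv : pinv A = M * Aᵀ := by rw [pinv, hG]
  have hMG : M * (Aᵀ * A) = 1 := by rw [hG, hM, nonsing_inv_mul _ hGdet]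
  have e1 : M * (C * Cᵀ) * W⁻¹ = W⁻¹ - M := by
    have : C * Cᵀ = (C * Cᵀ + W) - W := by abel
    rw [this, Matrix.mul_sub, Matrix.sub_mul, hM, nonsing_inv_mul _ hGdet, Matrix.one_mul,
      Matrix.mul_assoc, mul_nonsing_inv _ hWdet, Matrix.mul_one]
  have e2 : W⁻¹ * (C * Cᵀ) * M = W⁻¹ - M := by
    have := congrArg transpose e1
    simpa only [transpose_mul, transpose_sub, hMsymm, hWisymm, transpose_transpose,
      Matrix.mul_assoc] using this
  set D := 1 + Cᵀ * W⁻¹ * C with hD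
  have f1 : M * C * D = W⁻¹ * C := by
    have : M * C * D = M * C + M * (C * Cᵀ) * W⁻¹ * C := by
      rw [hD, Matrix.mul_add, Matrix.mul_one]
      simp only [Matrix.mul_assoc]
    rw [this, e1, Matrix.sub_mul]
    abel
  have f1' : D * (Cᵀ * M) = Cᵀ * W⁻¹ := by
    have := congrArg transpose f1
    have hDs : Dᵀ = D := by
      rw [hD, transpose_add, transpose_one, transpose_mul (Cᵀ * W⁻¹) C, transpose_mul Cᵀ W⁻¹,
        hWisymm, transpose_transpose, Matrix.mul_assoc]
    simpa only [transpose_mul, hMsymm, hWisymm, hDs] using this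
  have f2 : (1 - Cᵀ * M * C) * D = 1 := by
    have : (1 - Cᵀ * M * C) * D = D - Cᵀ * (M * C * D) := by
      rw [Matrix.sub_mul, Matrix.one_mul]
      simp only [Matrix.mul_assoc]
    rw [this, f1, hD, Matrix.mul_assoc]
    abel
  have hP : (Pmat A U S)ᵀ * Pmat A U S = S * (1 - Cᵀ * M * C) * S := by
    have hQs : ((1 : Matrix (Fin d) (Fin d) ℝ) - A * (M * Aᵀ))ᵀ = 1 - A * (M * Aᵀ) := by
      rw [transpose_sub, transpose_one, transpose_mul, transpose_mul, hMsymm, transpose_transpose,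
        Matrix.mul_assoc]
    have hQQ : (1 - A * (M * Aᵀ)) * (1 - A * (M * Aᵀ)) = 1 - A * (M * Aᵀ) := by
      have : A * (M * Aᵀ) * (A * (M * Aᵀ)) = A * (M * Aᵀ) := by
        calc _ = A * (M * (Aᵀ * A)) * (M * Aᵀ) := by simp only [Matrix.mul_assoc]
          _ = _ := by rw [hMG, Matrix.mul_one]
      rw [Matrix.sub_mul, Matrix.one_mul, Matrix.mul_sub, Matrix.mul_one, this, sub_self, sub_zero]
    rw [Pmat, hpinv, Matrix.neg_mul, Matrix.neg_mul, transpose_neg, Matrix.neg_mul, Matrix.mul_neg,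
      neg_neg, transpose_mul, transpose_mul, hQs, hS]
    calc S * (Uᵀ * (1 - A * (M * Aᵀ))) * ((1 - A * (M * Aᵀ)) * U * S)
        = S * (Uᵀ * ((1 - A * (M * Aᵀ)) * (1 - A * (M * Aᵀ))) * U) * S := by
          simp only [Matrix.mul_assoc]
      _ = S * (1 - Cᵀ * M * C) * S := by
          rw [hQQ, Matrix.mul_sub, Matrix.mul_one, Matrix.sub_mul, hU, hC, transpose_mul,
            transpose_transpose]
          simp only [Matrix.mul_assoc]
  have hPinv : ((Pmat A U S)ᵀ * Pmat A U S)⁻¹ = S⁻¹ * D * S⁻¹ := by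
    rw [hP, Matrix.mul_inv_rev, Matrix.mul_inv_rev, Matrix.inv_eq_right_inv f2, Matrix.mul_assoc]
  have hHH : Hmat A V * (Hmat A V)ᵀ = Vᵀ * M * V := by
    rw [Hmat, hpinv, transpose_mul, transpose_mul, hMsymm, transpose_transpose,
      transpose_transpose]
    calc Vᵀ * (M * Aᵀ) * (A * M * V) = Vᵀ * (M * (Aᵀ * A)) * (M * V) := by
          simp only [Matrix.mul_assoc]
      _ = _ := by rw [hMG, Matrix.mul_one, Matrix.mul_assoc]
  have hZ : Zmat A U V S * S⁻¹ = S⁻¹ + Vᵀ * (M * C) := by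
    rw [Zmat, hpinv, Matrix.add_mul, Matrix.one_mul, Matrix.mul_assoc _ S, mul_nonsing_inv _ hSdet,
      Matrix.mul_one, hC]
    simp only [Matrix.mul_assoc]
  have hZ' : S⁻¹ * (Zmat A U V S)ᵀ = S⁻¹ + Cᵀ * M * V := by
    have := congrArg transpose hZ
    simpa only [transpose_mul, transpose_add, hTsymm, hMsymm, transpose_transpose,
      Matrix.mul_assoc] using this
  rw [K1mat, hHH, hPinv]
  have h1 : Zmat A U V S * (S⁻¹ * D * S⁻¹) * (Zmat A U V S)ᵀ =
      (S⁻¹ + Vᵀ * (M * C)) * D * (S⁻¹ + Cᵀ * M * V) := by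
    rw [← hZ, ← hZ']
    simp only [Matrix.mul_assoc]
  have h2 : (S⁻¹ + Vᵀ * (M * C)) * D * (S⁻¹ + Cᵀ * M * V) =
      S⁻¹ * D * S⁻¹ + Vᵀ * (M * C * D) * S⁻¹ + S⁻¹ * (D * (Cᵀ * M)) * V +
        Vᵀ * (M * C * D) * (Cᵀ * M * V) := by
    simp only [Matrix.mul_add, Matrix.add_mul, Matrix.mul_assoc]
    abel
  have h3 : Vᵀ * (W⁻¹ * C) * (Cᵀ * M * V) = Vᵀ * W⁻¹ * V - Vᵀ * M * V := by
    calc Vᵀ * (W⁻¹ * C) * (Cᵀ * M * V) = Vᵀ * (W⁻¹ * (C * Cᵀ) * M) * V := by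
          simp only [Matrix.mul_assoc]
      _ = _ := by rw [e2, Matrix.mul_sub, Matrix.sub_mul]
  rw [h1, h2, f1, f1', h3, hD]
  simp only [Matrix.mul_add, Matrix.add_mul, Matrix.mul_one, Matrix.mul_assoc]
  abel

/-- Columns orthonormal in `ℝᵈ` can be completed to an orthogonal matrix. -/
lemma exists_orthogonal_completion {d r : ℕ} {U : Matrix (Fin d) (Fin r) ℝ} (hU : Uᵀ * U = 1) :
    ∃ U' : Matrix (Fin d) (Fin (d - r)) ℝ,
      U'ᵀ * U' = 1 ∧ U'ᵀ * U = 0 ∧ U * Uᵀ + U' * U'ᵀ = 1 := by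
  have hli : LinearIndependent ℝ fun i k => U k i := by
    refine (det_mul_transpose_ne_zero_iff _).mp ?_
    change (Uᵀ * U).det ≠ 0
    rw [hU, det_one]
    exact one_ne_zero
  obtain ⟨B, hB, hBU, hBx⟩ := exists_orthonormal_rows_orthogonal _ hli
  have hBU' : B * U = 0 := by
    ext i j
    exact congrFun (hBU j) i
  refine ⟨Bᵀ, by rwa [transpose_transpose], by rwa [transpose_transpose], ?_⟩
  rw [transpose_transpose]
  refine Matrix.ext_of_mulVec_single fun j => ?_
  set x : Fin d → ℝ := Pi.single j 1
  have h0 : Uᵀ *ᵥ (x - (U * Uᵀ) *ᵥ x) = 0 := by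
    rw [mulVec_sub, mulVec_mulVec, ← Matrix.mul_assoc, hU, Matrix.one_mul, sub_self]
  have h1 := hBx (x - (U * Uᵀ) *ᵥ x) fun i => congrFun h0 i
  rw [mulVec_sub B, mulVec_mulVec _ B, ← Matrix.mul_assoc, hBU', Matrix.zero_mul, zero_mulVec,
    sub_zero, mulVec_mulVec] at h1
  rw [add_mulVec, h1, one_mulVec]
  abel

/-- The projections of a Gaussian matrix on complementary orthogonal subspaces are independent
Gaussian arrays. -/
lemma measurePreserving_transpose_mul_prod {d N r m : ℕ} (v : NNReal)
    {U : Matrix (Fin d) (Fin r) ℝ} {U' : Matrix (Fin d) (Fin m) ℝ} (hU : Uᵀ * U = 1)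
    (hU' : U'ᵀ * U' = 1) (hU'U : U'ᵀ * U = 0) :
    MeasurePreserving (fun A : Matrix (Fin d) (Fin N) ℝ =>
        ((fun k a => (Aᵀ * U) k a, fun k a => (Aᵀ * U') k a) :
          (Fin N → Fin r → ℝ) × (Fin N → Fin m → ℝ)))
      (gaussMatrix d N v)
      ((gaussArray (Fin N) (Fin r) v).prod (gaussArray (Fin N) (Fin m) v)) := by
  have hB : fromRows Uᵀ U'ᵀ * (fromRows Uᵀ U'ᵀ)ᵀ = 1 := by
    have hUU' : Uᵀ * U' = 0 := by
      rw [← transpose_transpose (Uᵀ * U'), transpose_mul, transpose_transpose, hU'U,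
        transpose_zero]
    rw [transpose_fromRows, fromRows_mul_fromCols, transpose_transpose, transpose_transpose, hU,
      hU', hU'U, hUU', fromBlocks_one]
  have h1 := measurePreserving_transpose (Fin d) (Fin N) v
  have h2 := measurePreserving_pi (fun _ : Fin N => gaussVec (Fin d) v)
    (fun _ : Fin N => gaussVec (Fin r ⊕ Fin m) v) fun _ => measurePreserving_mulVec _ hB
  have h3 := measurePreserving_pi (fun _ : Fin N => gaussVec (Fin r ⊕ Fin m) v)
    (fun _ : Fin N => (gaussVec (Fin r) v).prod (gaussVec (Fin m) v))
    fun _ => measurePreserving_sumPiEquivProdPi fun _ => gaussianReal 0 v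
  have h4 := measurePreserving_arrowProdEquivProdArrow (Fin r → ℝ) (Fin m → ℝ) (Fin N)
    (fun _ => gaussVec (Fin r) v) (fun _ => gaussVec (Fin m) v)
  have h := h4.comp (h3.comp (h2.comp h1))
  refine cast (congrArg (fun f => MeasurePreserving f _ _) (funext fun A => ?_)) h
  refine Prod.ext ?_ ?_
  · ext k a
    exact dotProduct_comm (fun b => U b a) (fun b => A b k)
  · ext k a
    exact dotProduct_comm (fun b => U' b a) (fun b => A b k)

lemma integrable_and_integral_affine_mul {N r : ℕ} {v : NNReal} (V : Matrix (Fin N) (Fin r) ℝ)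
    (σ : Fin r → ℝ) (i j : Fin r) (k l : Fin N) :
    Integrable (fun Y : Fin N → Fin r → ℝ =>
        (V k i + Y k i * (σ i)⁻¹) * (V l j + Y l j * (σ j)⁻¹)) (gaussArray (Fin N) (Fin r) v) ∧
      ∫ Y, (V k i + Y k i * (σ i)⁻¹) * (V l j + Y l j * (σ j)⁻¹) ∂(gaussArray (Fin N) (Fin r) v) =
        V k i * V l j + (if k = l ∧ i = j then (v : ℝ) else 0) * ((σ i)⁻¹ * (σ j)⁻¹) := by
  have hfun : (fun Y : Fin N → Fin r → ℝ =>
      (V k i + Y k i * (σ i)⁻¹) * (V l j + Y l j * (σ j)⁻¹)) = fun Y =>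
      V k i * V l j + V k i * (σ j)⁻¹ * Y l j + V l j * (σ i)⁻¹ * Y k i +
        (Y k i * Y l j) * ((σ i)⁻¹ * (σ j)⁻¹) := by
    ext Y
    ring
  have i1 : Integrable (fun _ : Fin N → Fin r → ℝ => V k i * V l j)
    (gaussArray (Fin N) (Fin r) v) := integrable_const _
  have i2 := (integrable_gaussArray_apply (v := v) l j).const_mul (V k i * (σ j)⁻¹)
  have i3 := (integrable_gaussArray_apply (v := v) k i).const_mul (V l j * (σ i)⁻¹)
  have i4 := (integrable_gaussArray_apply_mul (v := v) k l i j).mul_const ((σ i)⁻¹ * (σ j)⁻¹)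
  rw [hfun]
  refine ⟨((i1.add i2).add i3).add i4, ?_⟩
  have e1 := integral_add ((i1.add i2).add i3) i4
  have e2 := integral_add (i1.add i2) i3
  have e3 := integral_add i1 i2
  simp only [Pi.add_apply] at e1 e2 e3
  rw [e1, e2, e3, integral_const_mul (V k i * (σ j)⁻¹), integral_const_mul (V l j * (σ i)⁻¹),
    integral_mul_const ((σ i)⁻¹ * (σ j)⁻¹), integral_gaussArray_apply, integral_gaussArray_apply,
    integral_gaussArray_apply_mul]
  simp

/-- The mean of `K₁` in finite dimension. -/
lemma integral_K1mat_apply {d N r : ℕ} (hdN : r + N + 2 < d) {v : NNReal} (hv : v ≠ 0)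
    {U : Matrix (Fin d) (Fin r) ℝ} (hU : Uᵀ * U = 1) {V : Matrix (Fin N) (Fin r) ℝ}
    (hV : Vᵀ * V = 1) {σ : Fin r → ℝ} (hσ : ∀ i, σ i ≠ 0) (i j : Fin r) :
    ∫ A, K1mat A U V (diagonal σ) i j ∂(gaussMatrix d N v) =
      if i = j then (σ i)⁻¹ ^ 2 + (v * (d - r - N - 1 : ℝ))⁻¹ * (1 + v * N * (σ i)⁻¹ ^ 2)
      else 0 := by
  obtain ⟨m, hm, U', hU', hU'U, hUU'⟩ : ∃ m, m = d - r ∧ ∃ U' : Matrix (Fin d) (Fin m) ℝ,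
      U'ᵀ * U' = 1 ∧ U'ᵀ * U = 0 ∧ U * Uᵀ + U' * U'ᵀ = 1 :=
    ⟨_, rfl, exists_orthogonal_completion hU⟩
  have hmN : N + 2 < m := by omega
  have hmcast : (m : ℝ) = d - r := by
    rw [hm, Nat.cast_sub (by omega)]
  have hSinv : (diagonal σ)⁻¹ = diagonal fun i => (σ i)⁻¹ := by
    refine Matrix.inv_eq_right_inv ?_
    rw [diagonal_mul_diagonal, ← diagonal_one]
    exact congrArg diagonal (funext fun i => mul_inv_cancel₀ (hσ i))
  have hSdet : IsUnit (diagonal σ).det := by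
    rw [det_diagonal]
    exact (Finset.prod_ne_zero_iff.mpr fun i _ => hσ i).isUnit
  have hmp := measurePreserving_transpose_mul_prod (N := N) v hU hU' hU'U
  set c₀ : ℝ := if i = j then (σ i)⁻¹ ^ 2 else 0 with hc₀
  let F : Fin N → Fin N → (Fin N → Fin r → ℝ) → ℝ := fun k l Y =>
    (V k i + Y k i * (σ i)⁻¹) * (V l j + Y l j * (σ j)⁻¹)
  let G : Fin N → Fin N → (Fin N → Fin m → ℝ) → ℝ := fun k l Y =>
    (Matrix.of Y * (Matrix.of Y)ᵀ)⁻¹ k l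
  let Φ : (Fin N → Fin r → ℝ) × (Fin N → Fin m → ℝ) → ℝ := fun p =>
    c₀ + ∑ l, ∑ k, F k l p.1 * G k l p.2
  have hΦ : Measurable Φ := by
    have : ∀ k l, Measurable (G k l) := measurable_gram_inv_apply
    fun_prop
  have hae : ∀ᵐ A ∂gaussMatrix d N v, K1mat A U V (diagonal σ) i j =
      Φ (fun k a => (Aᵀ * U) k a, fun k a => (Aᵀ * U') k a) := by
    have h1 : ∀ᵐ p ∂(gaussArray (Fin N) (Fin r) v).prod (gaussArray (Fin N) (Fin m) v),
        LinearIndependent ℝ p.2 :=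
      Measure.quasiMeasurePreserving_snd.ae (ae_linearIndependent_gaussArray hv N (by omega))
    filter_upwards [hmp.quasiMeasurePreserving.ae h1] with A hA
    have hdet := (det_mul_transpose_ne_zero_iff _).mpr hA
    rw [K1mat_eq A U U' V (diagonal σ) (diagonal_transpose σ) hSdet hU hUU' hdet, hSinv,
      Matrix.add_apply, diagonal_mul_diagonal, diagonal_apply]
    refine congrArg₂ (· + ·) ?_ ?_
    · simp only [hc₀, sq]
    · simp only [Matrix.mul_apply (M := _ * _), Matrix.mul_apply (M := Vᵀ + _), Finset.sum_mul]
      refine Finset.sum_congr rfl fun l _ => Finset.sum_congr rfl fun k _ => ?_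
      simp only [Matrix.add_apply, diagonal_mul, mul_diagonal, transpose_apply, F]
      change _ * (Aᵀ * U' * (Aᵀ * U')ᵀ)⁻¹ k l * _ = _ * (Aᵀ * U' * (Aᵀ * U')ᵀ)⁻¹ k l
      ring
  have hF := fun k l => integrable_and_integral_affine_mul (v := v) V σ i j k l
  have hG := fun k l => integrable_and_integral_gram_inv_apply hmN hv k l
  have hFG : ∀ k l, Integrable (fun p : (Fin N → Fin r → ℝ) × (Fin N → Fin m → ℝ) =>
      F k l p.1 * G k l p.2) ((gaussArray (Fin N) (Fin r) v).prod (gaussArray (Fin N) (Fin m) v)) :=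
    fun k l => (hF k l).1.mul_prod (hG k l).1
  have hVij : ∑ k, V k i * V k j = if i = j then 1 else 0 := by
    rw [← Matrix.one_apply, ← hV, Matrix.mul_apply]
    rfl
  calc ∫ A, K1mat A U V (diagonal σ) i j ∂(gaussMatrix d N v)
      = ∫ p, Φ p ∂((gaussArray (Fin N) (Fin r) v).prod (gaussArray (Fin N) (Fin m) v)) := by
        rw [integral_congr_ae hae, ← hmp.map_eq,
          integral_map hmp.measurable.aemeasurable hΦ.aestronglyMeasurable]
    _ = c₀ + ∑ l, ∑ k, (∫ Y, F k l Y ∂(gaussArray (Fin N) (Fin r) v)) *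
          ∫ Y, G k l Y ∂(gaussArray (Fin N) (Fin m) v) := by
        rw [integral_add (integrable_const _) (integrable_finsetSum _ fun l _ =>
          integrable_finsetSum _ fun k _ => hFG k l),
          integral_finsetSum _ fun l _ => integrable_finsetSum _ fun k _ => hFG k l]
        simp only [integral_finsetSum _ fun k _ => hFG k _, integral_prod_mul]
        simp
    _ = c₀ + ∑ l, (V l i * V l j + (if i = j then (v : ℝ) else 0) * ((σ i)⁻¹ * (σ j)⁻¹)) *
          (v * (m - N - 1 : ℝ))⁻¹ := by
        congr 1
        refine Finset.sum_congr rfl fun l _ => ?_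
        simp only [F, G, (hF _ _).2, (hG _ _).2, mul_ite, mul_zero, Finset.sum_ite_eq',
          Finset.mem_univ, if_true, true_and]
    _ = _ := by
        rw [← Finset.sum_mul, Finset.sum_add_distrib, hVij, hc₀, hmcast]
        split_ifs with hij
        · subst hij
          simp
          ring
        · simp

lemma tendsto_div_sub_of_tendsto_div {d : ℕ → ℕ} {c : ℝ} (hc : 1 < c)
    (hdc : Tendsto (fun N : ℕ => (d N : ℝ) / N) atTop (nhds c)) (a : ℝ) :
    Tendsto (fun N : ℕ => (N : ℝ) / (d N - N - a)) atTop (nhds (1 / (c - 1))) := by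
  have h0 : Tendsto (fun N : ℕ => (d N : ℝ) / N - 1 - a / N) atTop (nhds (c - 1)) := by
    simpa using (hdc.sub_const 1).sub (tendsto_const_div_atTop_nhds_zero_nat a)
  have h1 := h0.inv₀ (by linarith)
  rw [one_div]
  refine h1.congr' ?_
  filter_upwards [eventually_gt_atTop 0] with N hN
  have hN' : (N : ℝ) ≠ 0 := by positivity
  rw [← inv_div]
  field_simp

lemma eventually_add_lt_of_tendsto_div {d : ℕ → ℕ} {c : ℝ} (hc : 1 < c)
    (hdc : Tendsto (fun N : ℕ => (d N : ℝ) / N) atTop (nhds c)) (a : ℕ) :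
    ∀ᶠ N in atTop, a + N < d N := by
  have h0 : Tendsto (fun N : ℕ => (d N : ℝ) / N - a / N) atTop (nhds c) := by
    simpa using hdc.sub (tendsto_const_div_atTop_nhds_zero_nat (a : ℝ))
  filter_upwards [h0.eventually_const_lt hc, eventually_gt_atTop 0] with N hN hN0
  have hN' : (0 : ℝ) < N := by positivity
  rw [← sub_div, lt_div_iff₀ hN'] at hN
  have : (a + N : ℝ) < d N := by linarith
  exact_mod_cast this

/-- **Lemma (limit of `E[K₁]`, `c > 1`).**
Fix `c > 1`, `η > 0`, `r`, and an invertible diagonal `r × r` matrix `Σ = S` with positive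
diagonal entries.  For each `N`, let `d = d(N)` satisfy `d(N)/N → c`, let `A_N` be a `d × N`
random matrix with i.i.d. Gaussian entries of mean `0` and variance `η²/d`, let `U_N` be
`d × r` with `U_Nᵀ U_N = I_r` and `V_N` be `N × r` with `V_Nᵀ V_N = I_r`.  With
`H_N = V_Nᵀ A_N†`, `Z_N = I + V_Nᵀ A_N† U_N S`, `P_N = -(I - A_N A_N†) U_N S`, and
`K₁ = H_N H_Nᵀ + Z_N (P_Nᵀ P_N)⁻¹ Z_Nᵀ`, one has, entrywise,
`E[K₁] → (1/η²)(c/(c-1)) I_r + (c/(c-1)) S⁻²` as `N → ∞`. -/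
theorem stmt_13 (c η : ℝ) (hc : 1 < c) (hη : 0 < η) (r : ℕ) (hr : 0 < r)
    (S : Matrix (Fin r) (Fin r) ℝ) (σ : Fin r → ℝ) (hσ : ∀ i, 0 < σ i)
    (hSdiag : S = Matrix.diagonal σ)
    (d : ℕ → ℕ) (hd : ∀ N, 0 < d N)
    (hdc : Tendsto (fun N : ℕ => (d N : ℝ) / N) atTop (nhds c))
    (U : (N : ℕ) → Matrix (Fin (d N)) (Fin r) ℝ)
    (hU : ∀ N, r ≤ d N → (U N)ᵀ * U N = 1)
    (V : (N : ℕ) → Matrix (Fin N) (Fin r) ℝ)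
    (hV : ∀ N, r ≤ N → (V N)ᵀ * V N = 1)
    (i j : Fin r) :
    Tendsto
      (fun N : ℕ => ∫ A, K1mat A (U N) (V N) S i j
          ∂(gaussMatrix (d N) N ((η ^ 2 / (d N : ℝ)).toNNReal)))
      atTop
      (nhds ((((1 / η ^ 2) * (c / (c - 1))) • (1 : Matrix (Fin r) (Fin r) ℝ)
        + (c / (c - 1)) • (S⁻¹ * S⁻¹)) i j)) := by
  set g : ℕ → ℝ := fun N => (N : ℝ) / (d N - N - (r + 1)) with hg
  have hglim : Tendsto g atTop (nhds (1 / (c - 1))) := tendsto_div_sub_of_tendsto_div hc hdc _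
  have hmean : ∀ᶠ N in atTop,
      (if i = j then (σ i)⁻¹ ^ 2 + (d N : ℝ) / N * g N / η ^ 2 + g N * (σ i)⁻¹ ^ 2 else 0) =
        ∫ A, K1mat A (U N) (V N) S i j
          ∂(gaussMatrix (d N) N ((η ^ 2 / (d N : ℝ)).toNNReal)) := by
    filter_upwards [eventually_add_lt_of_tendsto_div hc hdc (r + 2), eventually_ge_atTop r]
      with N hN hrN
    have hd0 : (0 : ℝ) < d N := by exact_mod_cast hd N
    have hN0 : (N : ℝ) ≠ 0 := by
      have : 0 < N := by omega
      positivity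
    have hden : (d N : ℝ) - r - N - 1 ≠ 0 := by
      have : (r + 2 + N : ℝ) < d N := by exact_mod_cast hN
      linarith
    have hv : (η ^ 2 / (d N : ℝ)).toNNReal ≠ 0 := by
      rw [Ne, Real.toNNReal_eq_zero, not_le]
      positivity
    rw [hSdiag, integral_K1mat_apply (by omega) hv (hU N (by omega)) (hV N hrN)
      (fun k => (hσ k).ne') i j, Real.coe_toNNReal _ (by positivity)]
    have hg' : g N = N / (d N - r - N - 1 : ℝ) := by
      simp only [hg]
      congr 1
      ring
    split_ifs with hij
    · rw [hg']
      have := (hσ i).ne'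
      field_simp
      ring
    · rfl
  refine Tendsto.congr' hmean ?_
  have hSinv : S⁻¹ = diagonal fun k => (σ k)⁻¹ := by
    rw [hSdiag]
    refine Matrix.inv_eq_right_inv ?_
    rw [diagonal_mul_diagonal, ← diagonal_one]
    exact congrArg diagonal (funext fun k => mul_inv_cancel₀ (hσ k).ne')
  rw [hSinv, diagonal_mul_diagonal, Matrix.add_apply, Matrix.smul_apply, Matrix.smul_apply,
    Matrix.one_apply, diagonal_apply]
  split_ifs with hij
  · have hlim := (((hdc.mul hglim).div_const (η ^ 2)).const_add ((σ i)⁻¹ ^ 2)).add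
      (hglim.mul_const ((σ i)⁻¹ ^ 2))
    convert hlim using 2
    have hc1 : c - 1 ≠ 0 := by linarith
    have := (hσ i).ne'
    simp only [smul_eq_mul]
    field_simp
    ring
  · simp
end
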